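/- Let ε, δ ∈ (0,1) be such that 1/√δ is an integer, and let p_{XYZMN} be a joint distribution over finite sets 𝒳×𝒴×𝒵×ℳ×𝒩 satisfying the Markov conditions M−X−(Y,Z,N) and N−Y−(X,Z,M). Suppose R₁, R₂ ≥ 0 are reals satisfying Pr_{(x,y,z,m,n)~p}[ p_{M|X=x}(m)/p_{M|NZ=n,z}(m) ≤ δ·2^{R₁} and p_{N|Y=y}(n)/p_{N|MZ=m,z}(n) ≤ δ·2^{R₂} and (p_{M|X=x}(m)·p_{N|Y=y}(n))/p_{MN|Z=z}(m,n) ≤ δ⁴·2^{R₁+R₂−log log(max(|ℳ|,|𝒩|)/δ)} ] ≥ 1−ε. Then there exists an (R₁+3 log(1/δ), R₂+3 log(1/δ), ε+8δ) two-senders-one-receiver message compression with side information at the receiver for p_{XYZMN}. -/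

import Mathlib

open Finset Real
open scoped Classical

noncomputable section

variable {𝒳 𝒴 𝒵 ℳ 𝒩 : Type*} [Fintype 𝒳] [Fintype 𝒴] [Fintype 𝒵] [Fintype ℳ] [Fintype 𝒩]

/-- Marginal on `X`. -/
def margX (p : 𝒳 → 𝒴 → 𝒵 → ℳ → 𝒩 → ℝ) (x : 𝒳) : ℝ := ∑ y, ∑ z, ∑ m, ∑ n, p x y z m n

/-- Marginal on `Y`. -/
def margY (p : 𝒳 → 𝒴 → 𝒵 → ℳ → 𝒩 → ℝ) (y : 𝒴) : ℝ := ∑ x, ∑ z, ∑ m, ∑ n, p x y z m n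

/-- Marginal on `Z`. -/
def margZ (p : 𝒳 → 𝒴 → 𝒵 → ℳ → 𝒩 → ℝ) (z : 𝒵) : ℝ := ∑ x, ∑ y, ∑ m, ∑ n, p x y z m n

/-- Marginal on `(X, M)`. -/
def margXM (p : 𝒳 → 𝒴 → 𝒵 → ℳ → 𝒩 → ℝ) (x : 𝒳) (m : ℳ) : ℝ := ∑ y, ∑ z, ∑ n, p x y z m n

/-- Marginal on `(Y, N)`. -/
def margYN (p : 𝒳 → 𝒴 → 𝒵 → ℳ → 𝒩 → ℝ) (y : 𝒴) (n : 𝒩) : ℝ := ∑ x, ∑ z, ∑ m, p x y z m n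

/-- Marginal on `(X, Y, Z)`. -/
def margXYZ (p : 𝒳 → 𝒴 → 𝒵 → ℳ → 𝒩 → ℝ) (x : 𝒳) (y : 𝒴) (z : 𝒵) : ℝ := ∑ m, ∑ n, p x y z m n

/-- Marginal on `(M, Z)`. -/
def margMZ (p : 𝒳 → 𝒴 → 𝒵 → ℳ → 𝒩 → ℝ) (m : ℳ) (z : 𝒵) : ℝ := ∑ x, ∑ y, ∑ n, p x y z m n

/-- Marginal on `(N, Z)`. -/
def margNZ (p : 𝒳 → 𝒴 → 𝒵 → ℳ → 𝒩 → ℝ) (n : 𝒩) (z : 𝒵) : ℝ := ∑ x, ∑ y, ∑ m, p x y z m n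

/-- Marginal on `(M, N, Z)`. -/
def margMNZ (p : 𝒳 → 𝒴 → 𝒵 → ℳ → 𝒩 → ℝ) (m : ℳ) (n : 𝒩) (z : 𝒵) : ℝ := ∑ x, ∑ y, p x y z m n

/-- Conditional `p_{M|X=x}(m)`. -/
def condMX (p : 𝒳 → 𝒴 → 𝒵 → ℳ → 𝒩 → ℝ) (x : 𝒳) (m : ℳ) : ℝ := margXM p x m / margX p x

/-- Conditional `p_{N|Y=y}(n)`. -/
def condNY (p : 𝒳 → 𝒴 → 𝒵 → ℳ → 𝒩 → ℝ) (y : 𝒴) (n : 𝒩) : ℝ := margYN p y n / margY p y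

/-- Conditional `p_{M|N=n,Z=z}(m)`. -/
def condM_NZ (p : 𝒳 → 𝒴 → 𝒵 → ℳ → 𝒩 → ℝ) (m : ℳ) (n : 𝒩) (z : 𝒵) : ℝ :=
  margMNZ p m n z / margNZ p n z

/-- Conditional `p_{N|M=m,Z=z}(n)`. -/
def condN_MZ (p : 𝒳 → 𝒴 → 𝒵 → ℳ → 𝒩 → ℝ) (n : 𝒩) (m : ℳ) (z : 𝒵) : ℝ :=
  margMNZ p m n z / margMZ p m z

/-- Conditional `p_{MN|Z=z}(m,n)`. -/
def condMN_Z (p : 𝒳 → 𝒴 → 𝒵 → ℳ → 𝒩 → ℝ) (m : ℳ) (n : 𝒩) (z : 𝒵) : ℝ :=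
  margMNZ p m n z / margZ p z

/-- `p` is a probability mass function. -/
def IsDist (p : 𝒳 → 𝒴 → 𝒵 → ℳ → 𝒩 → ℝ) : Prop :=
  (∀ x y z m n, 0 ≤ p x y z m n) ∧ (∑ x, ∑ y, ∑ z, ∑ m, ∑ n, p x y z m n) = 1

/-- The Markov conditions `M − X − (Y,Z,N)` and `N − Y − (X,Z,M)`:
`p(x,y,z,m,n) = p_{XYZ}(x,y,z) · p_{M|X=x}(m) · p_{N|Y=y}(n)` whenever `p_{XYZ}(x,y,z) > 0`. -/
def MarkovCond (p : 𝒳 → 𝒴 → 𝒵 → ℳ → 𝒩 → ℝ) : Prop :=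
  ∀ x y z m n, 0 < margXYZ p x y z →
    p x y z m n = margXYZ p x y z * condMX p x m * condNY p y n

/-- An `(R₁, R₂, ε)` two-senders–one-receiver message compression scheme with side
information at the receiver, for the joint distribution `p` on `𝒳 × 𝒴 × 𝒵 × ℳ × 𝒩`:
shared randomness `qA` between Alice and Charlie and `qB` between Bob and Charlie
(mutually independent and independent of `(X,Y,Z)`), encoders `fA`, `fB` into message
sets of sizes at most `2^⌈R₁⌉` and `2^⌈R₂⌉`, and a decoder `g` whose output `(M',N')`
satisfies `½‖p_{XYZM'N'} − p_{XYZMN}‖₁ ≤ ε`. -/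
def IsTwoSenderScheme (p : 𝒳 → 𝒴 → 𝒵 → ℳ → 𝒩 → ℝ) (R₁ R₂ ε : ℝ) : Prop :=
  ∃ (kA kB cA cB : ℕ) (qA : Fin kA → ℝ) (qB : Fin kB → ℝ)
    (fA : 𝒳 → Fin kA → Fin cA) (fB : 𝒴 → Fin kB → Fin cB)
    (g : Fin cA → Fin cB → 𝒵 → Fin kA → Fin kB → ℳ × 𝒩),
    (∀ s, 0 ≤ qA s) ∧ (∑ s, qA s) = 1 ∧
    (∀ s, 0 ≤ qB s) ∧ (∑ s, qB s) = 1 ∧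
    ((cA : ℝ) ≤ (2 : ℝ) ^ (⌈R₁⌉ : ℤ)) ∧ ((cB : ℝ) ≤ (2 : ℝ) ^ (⌈R₂⌉ : ℤ)) ∧
    (1 / 2) * (∑ x, ∑ y, ∑ z, ∑ m, ∑ n,
      |(∑ sa, ∑ sb, qA sa * qB sb * margXYZ p x y z *
          (if g (fA x sa) (fB y sb) z sa sb = (m, n) then 1 else 0)) - p x y z m n|) ≤ ε

lemma ts_cdf (S : Finset ℝ) (hS : ∀ s ∈ S, 0 ≤ s) :
    ∃ r : ℝ → ℝ, (∀ u, 0 ≤ r u) ∧ ∀ s ∈ S, ∑ u ∈ S with u ≤ s, r u = s := by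
  induction S using Finset.induction_on_max with
  | empty => exact ⟨fun _ => 0, by simp, by simp⟩
  | insert a S ha ih =>
    obtain ⟨r, hr0, hr⟩ := ih (fun s hs => hS s (Finset.mem_insert_of_mem hs))
    have haS : a ∉ S := fun h => lt_irrefl _ (ha a h)
    have htot : ∑ u ∈ S, r u ≤ a := by
      by_cases hne : S.Nonempty
      · have h1 := hr _ (S.max'_mem hne)
        rw [Finset.filter_true_of_mem (fun u hu => S.le_max' u hu)] at h1
        rw [h1]; exact (ha _ (S.max'_mem hne)).le
      · rw [Finset.not_nonempty_iff_eq_empty] at hne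
        subst hne
        simpa using hS a (by simp)
    refine ⟨Function.update r a (a - ∑ u ∈ S, r u), ?_, ?_⟩
    · intro u
      by_cases h : u = a
      · subst h; simpa using htot
      · simpa [Function.update_of_ne h] using hr0 u
    · intro s hs
      have hcongr : ∀ T : Finset ℝ, T ⊆ S →
          ∑ u ∈ T, Function.update r a (a - ∑ u ∈ S, r u) u = ∑ u ∈ T, r u := by
        intro T hT
        refine Finset.sum_congr rfl fun u hu => ?_
        rw [Function.update_of_ne]
        rintro rfl
        exact haS (hT hu)
      rcases Finset.mem_insert.1 hs with rfl | hs
      · rw [Finset.filter_true_of_mem, Finset.sum_insert haS, hcongr S subset_rfl]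
        · simp
        · intro u hu
          rcases Finset.mem_insert.1 hu with rfl | hu
          · exact le_rfl
          · exact (ha u hu).le
      · rw [Finset.filter_insert, if_neg (not_le.2 (ha s hs)), hcongr _ (Finset.filter_subset _ _),
          hr s hs]

lemma ts_cdf_le (S : Finset ℝ) (r : ℝ → ℝ)
    (hr : ∀ s ∈ S, ∑ u ∈ S with u ≤ s, r u = s) (t : ℝ) (ht : 0 ≤ t) :
    ∑ u ∈ S with u ≤ t, r u ≤ t := by
  by_cases hne : (S.filter (· ≤ t)).Nonempty
  · have hm := Finset.mem_filter.1 ((S.filter (· ≤ t)).max'_mem hne)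
    have : S.filter (· ≤ t) = S.filter (· ≤ (S.filter (· ≤ t)).max' hne) := by
      ext u
      constructor
      · intro hu
        exact Finset.mem_filter.2 ⟨(Finset.mem_filter.1 hu).1, Finset.le_max' _ _ hu⟩
      · intro hu
        have := Finset.mem_filter.1 hu
        exact Finset.mem_filter.2 ⟨this.1, this.2.trans hm.2⟩
    rw [this, hr _ hm.1]
    exact hm.2
  · rw [Finset.not_nonempty_iff_eq_empty] at hne
    rw [hne]; simpa using ht

/-- existence of the sampler -/
lemma ts_sampler {α β : Type*} [Fintype α] [Fintype β] [Nonempty β] (P : α → β → ℝ)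
    (hP0 : ∀ x m, 0 ≤ P x m) (hP1 : ∀ x m, P x m ≤ 1) (c : ℕ) (hc : 0 < c) :
    ∃ (N : ℕ) (w : Fin N → ℝ) (mm : Fin N → β) (uu : Fin N → ℝ) (hh : Fin N → Fin c),
      (∀ a, 0 ≤ w a) ∧ (∑ a, w a = 1) ∧ (∀ a, 0 ≤ uu a) ∧ (∀ a, uu a ≤ 1) ∧
      (∀ x m, ∑ a, w a * (if uu a ≤ P x m ∧ mm a = m then 1 else 0) = P x m / Fintype.card β) ∧
      (∀ t : ℝ, 0 ≤ t → ∀ m h, ∑ a, w a * (if mm a = m ∧ hh a = h ∧ uu a ≤ t then 1 else 0)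
        ≤ t / (Fintype.card β * c)) := by
  let S : Finset ℝ := insert 1 (Finset.univ.image fun q : α × β => P q.1 q.2)
  have hS : ∀ s ∈ S, 0 ≤ s ∧ s ≤ 1 := by
    intro s hs
    rcases Finset.mem_insert.1 hs with rfl | hs
    · norm_num
    · obtain ⟨q, -, rfl⟩ := Finset.mem_image.1 hs
      exact ⟨hP0 _ _, hP1 _ _⟩
  obtain ⟨r, hr0, hr⟩ := ts_cdf S (fun s hs => (hS s hs).1)
  have hcard : (0 : ℝ) < Fintype.card β := by exact_mod_cast Fintype.card_pos
  have hcr : (0 : ℝ) < c := by exact_mod_cast hc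
  have hsub : ∀ t : ℝ, ∑ u : S, r u * (if (u : ℝ) ≤ t then 1 else 0) = ∑ u ∈ S with u ≤ t, r u := by
    intro t
    rw [Finset.sum_filter, ← Finset.sum_coe_sort S]
    simp
  have htot : ∑ u : S, r u = 1 := by
    have := hr 1 (Finset.mem_insert_self _ _)
    rw [← hsub] at this
    rw [← this]
    refine Finset.sum_congr rfl fun u _ => ?_
    rw [if_pos (hS u u.2).2, mul_one]
  let e := Fintype.equivFin (β × S × Fin c)
  have hsum : ∀ F : β × S × Fin c → ℝ,
      ∑ a, F (e.symm a) = ∑ m, ∑ u, ∑ h, F (m, u, h) := by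
    intro F
    rw [e.symm.sum_comp F, Fintype.sum_prod_type]
    simp [Fintype.sum_prod_type]
  refine ⟨_, fun a => r (e.symm a).2.1 / (Fintype.card β * c), fun a => (e.symm a).1,
    fun a => (e.symm a).2.1, fun a => (e.symm a).2.2, ?_, ?_, ?_, ?_, ?_, ?_⟩
  · intro a
    have := hr0 (e.symm a).2.1
    positivity
  · rw [hsum fun q => r q.2.1 / (Fintype.card β * c)]
    simp only [Finset.sum_const, Finset.card_univ, Fintype.card_fin, nsmul_eq_mul,
      ← Finset.mul_sum, ← Finset.sum_div, htot]
    field_simp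
  · exact fun a => (hS _ (e.symm a).2.1.2).1
  · exact fun a => (hS _ (e.symm a).2.1.2).2
  · intro x m
    rw [hsum fun q => r q.2.1 / (Fintype.card β * c) *
      (if (q.2.1 : ℝ) ≤ P x m ∧ q.1 = m then 1 else 0)]
    have h1 : ∀ u : S, ∀ m' : β, r u / (Fintype.card β * c) *
        (if (u : ℝ) ≤ P x m ∧ m' = m then (1 : ℝ) else 0)
        = (if m' = m then 1 else 0) *
          ((r u * (if (u : ℝ) ≤ P x m then 1 else 0)) / (Fintype.card β * c)) := by
      intro u m'
      by_cases h1 : m' = m <;> by_cases h2 : (u : ℝ) ≤ P x m <;> simp [h1, h2]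
    simp only [h1, Finset.sum_const, Finset.card_univ, Fintype.card_fin, nsmul_eq_mul,
      ← Finset.mul_sum, ← Finset.sum_div, hsub]
    rw [hr _ (Finset.mem_insert_of_mem (Finset.mem_image.2 ⟨(x, m), Finset.mem_univ _, rfl⟩)),
      ← Finset.sum_mul]
    simp
    field_simp
  · intro t ht m h
    rw [hsum fun q => r q.2.1 / (Fintype.card β * c) *
      (if q.1 = m ∧ q.2.2 = h ∧ (q.2.1 : ℝ) ≤ t then 1 else 0)]
    have h1 : ∀ u : S, ∀ m' : β, ∀ h' : Fin c, r u / (Fintype.card β * c) *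
        (if m' = m ∧ h' = h ∧ (u : ℝ) ≤ t then (1 : ℝ) else 0)
        = (if m' = m then 1 else 0) * (((r u * (if (u : ℝ) ≤ t then 1 else 0)) /
          (Fintype.card β * c)) * (if h' = h then 1 else 0)) := by
      intro u m' h'
      by_cases h1 : m' = m <;> by_cases h2 : (u : ℝ) ≤ t <;> by_cases h3 : h' = h <;>
        simp [h1, h2, h3]
    simp only [h1, ← Finset.mul_sum]
    simp only [Finset.sum_ite_eq', Finset.mem_univ, if_true, mul_one, ← Finset.sum_div, hsub,
      ← Finset.sum_mul, one_mul]
    exact div_le_div_of_nonneg_right (ts_cdf_le S r hr t ht) (by positivity)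

/-- dyadic bound for products -/
lemma ts_dyadic {Ω Ω' : Type*} [Fintype Ω] [Fintype Ω'] (w : Ω → ℝ) (w' : Ω' → ℝ)
    (hw : ∀ a, 0 ≤ w a) (hw' : ∀ a, 0 ≤ w' a) (u : Ω → ℝ) (v : Ω' → ℝ)
    (hu0 : ∀ a, 0 ≤ u a) (hu1 : ∀ a, u a ≤ 1) (hv1 : ∀ a, v a ≤ 1) (C C' : ℝ)

    (hC1 : ∀ t : ℝ, 0 ≤ t → ∑ a, w a * (if u a ≤ t then 1 else 0) ≤ C * t)
    (hC1' : ∀ t : ℝ, 0 ≤ t → ∑ a, w' a * (if v a ≤ t then 1 else 0) ≤ C' * t)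
    (t : ℝ) (ht : 0 ≤ t) (k : ℕ) :
    ∑ a, ∑ b, w a * w' b * (if u a * v b ≤ t then 1 else 0) ≤ C * C' * ((1/2)^k + 2 * k * t) := by
  have hprod : ∀ s s' : ℝ, 0 ≤ s → 0 ≤ s' →
      ∑ a, ∑ b, w a * w' b * ((if u a ≤ s then 1 else 0) * (if v b ≤ s' then 1 else 0))
        ≤ C * s * (C' * s') := by
    intro s s' hs hs'
    have : ∑ a, ∑ b, w a * w' b * ((if u a ≤ s then 1 else 0) * (if v b ≤ s' then 1 else 0))
      = (∑ a, w a * (if u a ≤ s then 1 else 0)) * (∑ b, w' b * (if v b ≤ s' then 1 else 0)) := by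
      rw [Finset.sum_mul_sum]
      exact Finset.sum_congr rfl fun a _ => Finset.sum_congr rfl fun b _ => by ring
    rw [this]
    refine mul_le_mul (hC1 s hs) (hC1' s' hs') ?_ ?_
    · exact Finset.sum_nonneg fun b _ => mul_nonneg (hw' b) (by split_ifs <;> norm_num)
    · exact le_trans (Finset.sum_nonneg fun b _ => mul_nonneg (hw b) (by split_ifs <;> norm_num))
        (hC1 s hs)
  have key : ∀ k : ℕ, ∑ a, ∑ b, w a * w' b * (if u a * v b ≤ t then 1 else 0) ≤
      ∑ a, ∑ b, w a * w' b * (if u a * v b ≤ t ∧ v b ≤ (1/2)^k then 1 else 0)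
        + 2 * k * t * (C * C') := by
    intro k
    induction k with
    | zero => simp [hv1]
    | succ k ih =>
      refine ih.trans ?_
      have h2 := hprod (t * 2^(k+1)) ((1/2)^k) (by positivity) (by positivity)
      have h3 : ∑ a, ∑ b, w a * w' b * (if u a * v b ≤ t ∧ v b ≤ (1/2)^k then 1 else 0) ≤
        ∑ a, ∑ b, w a * w' b * (if u a * v b ≤ t ∧ v b ≤ (1/2)^(k+1) then 1 else 0) +
        ∑ a, ∑ b, w a * w' b * ((if u a ≤ t * 2^(k+1) then 1 else 0) *
          (if v b ≤ (1/2)^k then 1 else 0)) := by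
        simp only [← Finset.sum_add_distrib, ← mul_add]
        refine Finset.sum_le_sum fun a _ => Finset.sum_le_sum fun b _ => ?_
        refine mul_le_mul_of_nonneg_left ?_ (mul_nonneg (hw a) (hw' b))
        by_cases h : u a * v b ≤ t ∧ v b ≤ (1/2)^k
        · rw [if_pos h, if_pos h.2]
          by_cases h4 : v b ≤ (1/2)^(k+1)
          · rw [if_pos ⟨h.1, h4⟩]; split_ifs <;> norm_num
          · have h8 : u a ≤ t * 2^(k+1) := by
              push Not at h4
              have : u a * (1/2)^(k+1) ≤ t :=
                le_trans (mul_le_mul_of_nonneg_left h4.le (hu0 a)) h.1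
              calc u a = u a * (1/2)^(k+1) * 2^(k+1) := by
                    rw [mul_assoc, ← mul_pow]; norm_num
                _ ≤ _ := mul_le_mul_of_nonneg_right this (by positivity)
            rw [if_pos h8]
            split_ifs <;> norm_num
        · rw [if_neg h]
          split_ifs <;> norm_num
      have h5 : C * (t * 2^(k+1)) * (C' * (1/2)^k) = 2 * t * (C * C') := by
        have : (2:ℝ)^k * (1/2)^k = 1 := by rw [← mul_pow]; norm_num
        calc _ = 2 * t * (C * C') * ((2:ℝ)^k * (1/2)^k) := by ring
          _ = _ := by rw [this, mul_one]
      push_cast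
      linarith
  refine (key k).trans ?_
  have h6 := hprod 1 ((1/2)^k) (by norm_num) (by positivity)
  have h7 : ∑ a, ∑ b, w a * w' b * (if u a * v b ≤ t ∧ v b ≤ (1/2)^k then 1 else 0) ≤
     ∑ a, ∑ b, w a * w' b * ((if u a ≤ 1 then 1 else 0) * (if v b ≤ (1/2)^k then 1 else 0)) := by
    refine Finset.sum_le_sum fun a _ => Finset.sum_le_sum fun b _ => ?_
    refine mul_le_mul_of_nonneg_left ?_ (mul_nonneg (hw a) (hw' b))
    rw [if_pos (hu1 a)]
    split_ifs <;> simp_all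
  linarith

/-- product form -/
lemma ts_E_prod {Ω : Type*} [Fintype Ω] (K : ℕ) (w : Ω → ℝ) (f : Fin K → Ω → ℝ) :
    ∑ s : Fin K → Ω, (∏ k, w (s k)) * ∏ k, f k (s k) = ∏ k, ∑ a, w a * f k a := by
  rw [Finset.prod_univ_sum]
  simp [Finset.prod_mul_distrib]

lemma ts_E1 {Ω : Type*} [Fintype Ω] (K : ℕ) (w : Ω → ℝ) (hw : ∑ a, w a = 1) (F : Ω → ℝ)
    (i : Fin K) :
    ∑ s : Fin K → Ω, (∏ k, w (s k)) * F (s i) = ∑ a, w a * F a := by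
  have h := ts_E_prod K w (fun k a => if k = i then F a else 1)
  simp only [Finset.prod_ite_eq', Finset.mem_univ, if_true] at h
  rw [h, Finset.prod_eq_single i]
  · simp
  · intro b _ hb; simp [hb, hw]
  · simp

lemma ts_E0 {Ω : Type*} [Fintype Ω] (K : ℕ) (w : Ω → ℝ) (hw : ∑ a, w a = 1) :
    ∑ s : Fin K → Ω, (∏ k, w (s k)) = 1 := by
  have h := ts_E_prod K w (fun k a => 1)
  simpa [hw] using h

lemma ts_E2 {Ω : Type*} [Fintype Ω] (K : ℕ) (w : Ω → ℝ) (hw : ∑ a, w a = 1) (H : Ω → Ω → ℝ)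
    (i i' : Fin K) (hii : i' ≠ i) :
    ∑ s : Fin K → Ω, (∏ k, w (s k)) * H (s i) (s i') = ∑ a, ∑ a', w a * w a' * H a a' := by
  have h1 : ∀ s : Fin K → Ω, (∏ k, w (s k)) * H (s i) (s i') =
      ∑ b, (∏ k, w (s k)) * ∏ k, (if k = i then (if s k = b then 1 else 0) else
        if k = i' then H b (s k) else 1) := by
    intro s
    rw [← Finset.mul_sum]
    congr 1
    have h2 : ∀ b, ∏ k, (if k = i then (if s k = b then (1:ℝ) else 0) else
        if k = i' then H b (s k) else 1) = (if s i = b then 1 else 0) * H b (s i') := by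
      intro b
      rw [Finset.prod_eq_mul i i' hii.symm]
      · simp [hii]
      · intro c _ hc; simp [hc.1, hc.2]
      · simp
      · simp
    simp [h2]
  simp_rw [h1]
  rw [Finset.sum_comm]
  refine Finset.sum_congr rfl fun b _ => ?_
  rw [ts_E_prod K w (fun k a => if k = i then (if a = b then 1 else 0) else
        if k = i' then H b a else 1), Finset.prod_eq_mul i i' hii.symm]
  · simp [hii, Finset.mul_sum, mul_assoc]
  · intro c _ hc; simp [hc.1, hc.2, hw]
  · simp
  · simp

def tsFst {Ω : Type*} {K : ℕ} (acc : Ω → Prop) (s : Fin K → Ω) (i : Fin K) : Prop :=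
  acc (s i) ∧ ∀ k, k < i → ¬ acc (s k)

lemma tsFst_unique {Ω : Type*} {K : ℕ} (acc : Ω → Prop) (s : Fin K → Ω) (i j : Fin K)
    (hi : tsFst acc s i) (hj : tsFst acc s j) : i = j := by
  rcases lt_trichotomy i j with h | h | h
  · exact absurd hi.1 (hj.2 i h)
  · exact h
  · exact absurd hj.1 (hi.2 j h)

lemma ts_Efst {Ω : Type*} [Fintype Ω] (K : ℕ) (w : Ω → ℝ) (hw : ∑ a, w a = 1)
    (acc B : Ω → Prop) (q qB : ℝ) (hq : ∑ a, w a * (if acc a then 1 else 0) = q)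
    (hqB : ∑ a, w a * (if acc a ∧ B a then 1 else 0) = qB) (hq0 : q ≠ 0) :
    ∑ s : Fin K → Ω, (∏ k, w (s k)) * ∑ i, (if tsFst acc s i ∧ B (s i) then 1 else 0)
      = qB / q * (1 - (1 - q)^K) := by
  have hneg : ∑ a, w a * (if acc a then 0 else 1) = 1 - q := by
    rw [← hq, eq_sub_iff_add_eq, ← Finset.sum_add_distrib]
    refine Eq.trans ?_ hw
    refine Finset.sum_congr rfl fun a _ => ?_
    split_ifs <;> ring
  have h1 : ∀ i : Fin K, ∑ s : Fin K → Ω, (∏ k, w (s k)) *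
      (if tsFst acc s i ∧ B (s i) then (1:ℝ) else 0) = (1 - q)^(i:ℕ) * qB := by
    intro i
    have h2 : ∀ s : Fin K → Ω, (if tsFst acc s i ∧ B (s i) then (1:ℝ) else 0) =
      ∏ k, (if k < i then (if acc (s k) then 0 else 1) else
        if k = i then (if acc (s k) ∧ B (s k) then 1 else 0) else 1) := by
      intro s
      by_cases h : tsFst acc s i ∧ B (s i)
      · rw [if_pos h, Finset.prod_eq_one]
        intro k _
        by_cases hk : k < i
        · simp [hk, h.1.2 k hk]
        · by_cases hk' : k = i
          · subst hk'; simp [h.1.1, h.2]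
          · simp [hk, hk']
      · rw [if_neg h]
        symm
        by_cases hA : acc (s i) ∧ B (s i)
        · have : ∃ k, k < i ∧ acc (s k) := by
            by_contra hcon
            push Not at hcon
            exact h ⟨⟨hA.1, hcon⟩, hA.2⟩
          obtain ⟨k, hk, hk'⟩ := this
          exact Finset.prod_eq_zero (Finset.mem_univ k) (by simp [hk, hk'])
        · exact Finset.prod_eq_zero (Finset.mem_univ i) (by simp [hA])
    simp_rw [h2]
    rw [ts_E_prod K w (fun k a => if k < i then (if acc a then 0 else 1) else
        if k = i then (if acc a ∧ B a then 1 else 0) else 1)]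
    have h3 : ∀ k, ∑ a, w a * (if k < i then (if acc a then 0 else 1) else
        if k = i then (if acc a ∧ B a then 1 else 0) else 1) =
        (if k < i then (1 - q) else 1) * (if k = i then qB else 1) := by
      intro k
      by_cases hk : k < i
      · simp only [hk, if_true, hneg, hk.ne, if_false, mul_one]
      · by_cases hk' : k = i
        · simp only [hk', lt_irrefl, if_false, if_true, hqB, one_mul]
        · simp [hk, hk', hw]
    simp_rw [h3]
    rw [Finset.prod_mul_distrib, Finset.prod_ite_eq', if_pos (Finset.mem_univ _)]
    congr 1
    rw [Finset.prod_ite]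
    have hcd : (Finset.univ.filter (fun x : Fin K => x < i)).card = (i : ℕ) := by
      rw [← Fin.card_Iio i]; congr 1; ext; simp
    simp [hcd]
  simp_rw [Finset.mul_sum]
  rw [Finset.sum_comm]
  simp_rw [h1]
  rw [← Finset.sum_mul, Fin.sum_univ_eq_sum_range (fun i => (1-q)^i), geom_sum_eq]
  · have : (1 - q - 1) = -q := by ring
    rw [this]; field_simp; ring
  · intro h; apply hq0; linarith

structure TsSampler (β : Type*) [Fintype β] (c : ℕ) where
  N : ℕ
  w : Fin N → ℝ
  mm : Fin N → β
  uu : Fin N → ℝ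
  hh : Fin N → Fin c
  w0 : ∀ a, 0 ≤ w a
  w1 : ∑ a, w a = 1
  u0 : ∀ a, 0 ≤ uu a
  u1 : ∀ a, uu a ≤ 1
  hit : ∀ t : ℝ, 0 ≤ t → ∀ m h, ∑ a, w a * (if mm a = m ∧ hh a = h ∧ uu a ≤ t then 1 else 0)
        ≤ t / (Fintype.card β * c)

def TsSampler.acc {β : Type*} [Fintype β] {c : ℕ} (S : TsSampler β c) (P : β → ℝ)
    (a : Fin S.N) : Prop := S.uu a ≤ P (S.mm a)

def TsSampler.pr {β : Type*} [Fintype β] {c : ℕ} (S : TsSampler β c) {K : ℕ}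
    (s : Fin K → Fin S.N) : ℝ := ∏ k, S.w (s k)

lemma TsSampler.pr0 {β : Type*} [Fintype β] {c : ℕ} (S : TsSampler β c) {K : ℕ}
    (s : Fin K → Fin S.N) : 0 ≤ S.pr s := Finset.prod_nonneg fun _ _ => S.w0 _

lemma ts_hit1 {β : Type*} [Fintype β] {c : ℕ} (S : TsSampler β c) (t : β → ℝ)
    (ht : ∀ m, 0 ≤ t m) (h : Fin c) :
    ∑ a, S.w a * (if S.hh a = h ∧ S.uu a ≤ t (S.mm a) then 1 else 0)
      ≤ (∑ m, t m) / (Fintype.card β * c) := by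
  have h1 : ∀ a, S.w a * (if S.hh a = h ∧ S.uu a ≤ t (S.mm a) then 1 else 0) =
      ∑ m, S.w a * (if S.mm a = m ∧ S.hh a = h ∧ S.uu a ≤ t m then 1 else 0) := by
    intro a
    rw [← Finset.mul_sum]
    congr 1
    simp [ite_and]
  simp_rw [h1]
  rw [Finset.sum_comm, Finset.sum_div]
  exact Finset.sum_le_sum fun m _ => S.hit _ (ht m) m h

lemma ts_hit2 {β γ : Type*} [Fintype β] [Fintype γ] {c c' : ℕ} (S : TsSampler β c)
    (S' : TsSampler γ c') (t : β → γ → ℝ)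
    (ht : ∀ m n, 0 ≤ t m n) (h : Fin c) (h' : Fin c') (k : ℕ) :
    ∑ a, ∑ b, S.w a * S'.w b * (if S.hh a = h ∧ S'.hh b = h' ∧
        S.uu a * S'.uu b ≤ t (S.mm a) (S'.mm b) then 1 else 0)
      ≤ 1 / (Fintype.card β * c) * (1 / (Fintype.card γ * c')) *
        (Fintype.card β * Fintype.card γ * (1/2)^k + 2 * k * ∑ m, ∑ n, t m n) := by
  have h1 : ∀ a b, S.w a * S'.w b * (if S.hh a = h ∧ S'.hh b = h' ∧
        S.uu a * S'.uu b ≤ t (S.mm a) (S'.mm b) then (1:ℝ) else 0) =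
      ∑ m, ∑ n, (S.w a * (if S.mm a = m ∧ S.hh a = h then 1 else 0)) *
        (S'.w b * (if S'.mm b = n ∧ S'.hh b = h' then 1 else 0)) *
        (if S.uu a * S'.uu b ≤ t m n then 1 else 0) := by
    intro a b
    rw [Finset.sum_eq_single (S.mm a), Finset.sum_eq_single (S'.mm b)]
    · by_cases h1 : S.hh a = h <;> by_cases h2 : S'.hh b = h' <;> simp [h1, h2]
    · intro n _ hn
      simp [hn.symm]
    · simp
    · intro m _ hm
      simp [hm.symm]
    · simp
  simp_rw [h1]
  have h2 : ∀ F : Fin S.N → Fin S'.N → β → γ → ℝ, ∑ a, ∑ b, ∑ m, ∑ n, F a b m n =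
      ∑ m, ∑ n, ∑ a, ∑ b, F a b m n := by
    intro F
    calc _ = ∑ a, ∑ m, ∑ b, ∑ n, F a b m n := Finset.sum_congr rfl fun a _ => Finset.sum_comm
      _ = ∑ m, ∑ a, ∑ b, ∑ n, F a b m n := Finset.sum_comm
      _ = ∑ m, ∑ a, ∑ n, ∑ b, F a b m n := Finset.sum_congr rfl fun a _ =>
          Finset.sum_congr rfl fun b _ => Finset.sum_comm
      _ = _ := Finset.sum_congr rfl fun a _ => Finset.sum_comm
  rw [h2]
  calc _ ≤ ∑ m, ∑ n, 1 / (Fintype.card β * c : ℝ) * (1 / (Fintype.card γ * c')) *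
        ((1/2)^k + 2 * k * t m n) := by
        refine Finset.sum_le_sum fun m _ => Finset.sum_le_sum fun n _ => ?_
        refine ts_dyadic (fun a => S.w a * (if S.mm a = m ∧ S.hh a = h then 1 else 0))
          (fun b => S'.w b * (if S'.mm b = n ∧ S'.hh b = h' then 1 else 0)) ?_ ?_ S.uu S'.uu
          S.u0 S.u1 S'.u1 _ _ ?_ ?_ (t m n) (ht m n) k
        · exact fun a => mul_nonneg (S.w0 a) (by split_ifs <;> norm_num)
        · exact fun a => mul_nonneg (S'.w0 a) (by split_ifs <;> norm_num)
        · intro s hs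
          have := S.hit s hs m h
          rw [one_div_mul_eq_div]
          refine le_trans (le_of_eq ?_) this
          refine Finset.sum_congr rfl fun a _ => ?_
          rw [mul_assoc]; congr 1
          split_ifs <;> simp_all
        · intro s hs
          have := S'.hit s hs n h'
          rw [one_div_mul_eq_div]
          refine le_trans (le_of_eq ?_) this
          refine Finset.sum_congr rfl fun a _ => ?_
          rw [mul_assoc]; congr 1
          split_ifs <;> simp_all
    _ = _ := by
        simp only [← Finset.mul_sum, Finset.sum_add_distrib, Finset.sum_const, Finset.card_univ,
          nsmul_eq_mul]
        ring

lemma ts_coll1 {β γ : Type*} [Fintype β] [Fintype γ] {c c' : ℕ} (S : TsSampler β c)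
    (S' : TsSampler γ c') {K K' : ℕ} (A : Fin S.N → Prop) (B : Fin S'.N → Prop) (qA qB : ℝ)
    (hA : ∑ a, S.w a * (if A a then 1 else 0) = qA)
    (hB : ∑ a, S'.w a * (if B a then 1 else 0) = qB)
    (t : β → γ → ℝ) (ht : ∀ m n, 0 ≤ t m n) (T : ℝ) (hT : ∀ n, ∑ m, t m n ≤ T)
    (i i' : Fin K) (j : Fin K') (hi : i' ≠ i) :
    ∑ s : Fin K → Fin S.N, ∑ r : Fin K' → Fin S'.N, S.pr s * S'.pr r *
      (if A (s i) ∧ B (r j) ∧ S.hh (s i') = S.hh (s i) ∧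
        S.uu (s i') ≤ t (S.mm (s i')) (S'.mm (r j)) then 1 else 0)
      ≤ qA * qB * (T / (Fintype.card β * c)) := by
  rw [Finset.sum_comm]
  have h1 : ∀ r : Fin K' → Fin S'.N, ∑ s : Fin K → Fin S.N, S.pr s * S'.pr r *
      (if A (s i) ∧ B (r j) ∧ S.hh (s i') = S.hh (s i) ∧
        S.uu (s i') ≤ t (S.mm (s i')) (S'.mm (r j)) then 1 else 0)
      ≤ S'.pr r * ((if B (r j) then 1 else 0) * (qA * (T / (Fintype.card β * c)))) := by
    intro r
    have h2 := ts_E2 K S.w S.w1 (fun a a' => if A a ∧ B (r j) ∧ S.hh a' = S.hh a ∧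
        S.uu a' ≤ t (S.mm a') (S'.mm (r j)) then 1 else 0) i i' hi
    have h3 : ∑ s : Fin K → Fin S.N, S.pr s * S'.pr r *
      (if A (s i) ∧ B (r j) ∧ S.hh (s i') = S.hh (s i) ∧
        S.uu (s i') ≤ t (S.mm (s i')) (S'.mm (r j)) then 1 else 0) =
        S'.pr r * ∑ s : Fin K → Fin S.N, (∏ k, S.w (s k)) *
      (if A (s i) ∧ B (r j) ∧ S.hh (s i') = S.hh (s i) ∧
        S.uu (s i') ≤ t (S.mm (s i')) (S'.mm (r j)) then 1 else 0) := by
      rw [Finset.mul_sum]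
      refine Finset.sum_congr rfl fun s _ => ?_
      rw [TsSampler.pr]; ring
    rw [h3, h2]
    refine mul_le_mul_of_nonneg_left ?_ (S'.pr0 r)
    rw [← hA, Finset.sum_mul, Finset.mul_sum]
    refine Finset.sum_le_sum fun a _ => ?_
    have h4 := (ts_hit1 S (fun m => t m (S'.mm (r j))) (fun m => ht m _) (S.hh a)).trans
      (div_le_div_of_nonneg_right (hT (S'.mm (r j))) (by positivity))
    have h5 : ∑ a', S.w a * S.w a' * (if A a ∧ B (r j) ∧ S.hh a' = S.hh a ∧
        S.uu a' ≤ t (S.mm a') (S'.mm (r j)) then 1 else 0) =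
        (if B (r j) then 1 else 0) * (S.w a * (if A a then 1 else 0) * ∑ a', S.w a' *
          (if S.hh a' = S.hh a ∧ S.uu a' ≤ t (S.mm a') (S'.mm (r j)) then 1 else 0)) := by
      by_cases hh1 : A a <;> by_cases hh2 : B (r j) <;> simp [hh1, hh2, Finset.mul_sum]
    rw [h5]
    refine mul_le_mul_of_nonneg_left ?_ (by split_ifs <;> norm_num)
    exact mul_le_mul_of_nonneg_left h4 (mul_nonneg (S.w0 a) (by split_ifs <;> norm_num))
  refine (Finset.sum_le_sum fun r _ => h1 r).trans (le_of_eq ?_)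
  have h6 := ts_E1 K' S'.w S'.w1 (fun b => (if B b then 1 else 0) *
    (qA * (T / (Fintype.card β * c)))) j
  refine h6.trans ?_
  rw [← hB]
  simp_rw [← mul_assoc]
  rw [← Finset.sum_mul, ← Finset.sum_mul]
  ring

lemma ts_coll2 {β γ : Type*} [Fintype β] [Fintype γ] {c c' : ℕ} (S : TsSampler β c)
    (S' : TsSampler γ c') {K K' : ℕ} (A : Fin S.N → Prop) (B : Fin S'.N → Prop) (qA qB : ℝ)
    (hA : ∑ a, S.w a * (if A a then 1 else 0) = qA)
    (hB : ∑ a, S'.w a * (if B a then 1 else 0) = qB)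
    (t : β → γ → ℝ) (X : ℝ)
    (hX : ∀ h h', ∑ a, ∑ b, S.w a * S'.w b * (if S.hh a = h ∧ S'.hh b = h' ∧
        S.uu a * S'.uu b ≤ t (S.mm a) (S'.mm b) then 1 else 0) ≤ X)
    (i i' : Fin K) (j j' : Fin K') (hi : i' ≠ i) (hj : j' ≠ j) :
    ∑ s : Fin K → Fin S.N, ∑ r : Fin K' → Fin S'.N, S.pr s * S'.pr r *
      (if A (s i) ∧ B (r j) ∧ S.hh (s i') = S.hh (s i) ∧ S'.hh (r j') = S'.hh (r j) ∧
        S.uu (s i') * S'.uu (r j') ≤ t (S.mm (s i')) (S'.mm (r j')) then 1 else 0)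
      ≤ qA * qB * X := by
  let G : Fin S.N → Fin S.N → Fin S'.N → Fin S'.N → ℝ := fun a a' b b' =>
    if A a ∧ B b ∧ S.hh a' = S.hh a ∧ S'.hh b' = S'.hh b ∧
        S.uu a' * S'.uu b' ≤ t (S.mm a') (S'.mm b') then 1 else 0
  have h1 : ∑ s : Fin K → Fin S.N, ∑ r : Fin K' → Fin S'.N, S.pr s * S'.pr r *
      G (s i) (s i') (r j) (r j') = ∑ a, ∑ a', S.w a * S.w a' * ∑ b, ∑ b', S'.w b * S'.w b' *
        G a a' b b' := by
    rw [← ts_E2 K S.w S.w1 (fun a a' => ∑ b, ∑ b', S'.w b * S'.w b' * G a a' b b') i i' hi]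
    refine Finset.sum_congr rfl fun s _ => ?_
    rw [← ts_E2 K' S'.w S'.w1 (fun b b' => G (s i) (s i') b b') j j' hj, Finset.mul_sum]
    refine Finset.sum_congr rfl fun r _ => ?_
    rw [TsSampler.pr, TsSampler.pr]; ring
  refine (le_of_eq h1).trans ?_
  have h2 : ∀ a b, ∑ a', ∑ b', S.w a * S.w a' * (S'.w b * S'.w b' * G a a' b b') ≤
      (S.w a * (if A a then 1 else 0)) * ((S'.w b * (if B b then 1 else 0)) * X) := by
    intro a b
    have h3 : ∑ a', ∑ b', S.w a * S.w a' * (S'.w b * S'.w b' * G a a' b b') =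
      (S.w a * (if A a then 1 else 0)) * ((S'.w b * (if B b then 1 else 0)) *
        ∑ a', ∑ b', S.w a' * S'.w b' * (if S.hh a' = S.hh a ∧ S'.hh b' = S'.hh b ∧
        S.uu a' * S'.uu b' ≤ t (S.mm a') (S'.mm b') then 1 else 0)) := by
      simp only [G, Finset.mul_sum]
      refine Finset.sum_congr rfl fun a' _ => Finset.sum_congr rfl fun b' _ => ?_
      by_cases hh1 : A a <;> by_cases hh2 : B b <;> simp only [hh1, hh2, if_true, if_false,
        true_and, false_and, mul_zero, zero_mul, mul_one]
      ring
    rw [h3]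
    refine mul_le_mul_of_nonneg_left ?_ (mul_nonneg (S.w0 a) (by split_ifs <;> norm_num))
    exact mul_le_mul_of_nonneg_left (hX _ _) (mul_nonneg (S'.w0 b) (by split_ifs <;> norm_num))
  calc _ = ∑ a, ∑ b, ∑ a', ∑ b', S.w a * S.w a' * (S'.w b * S'.w b' * G a a' b b') := by
        refine Finset.sum_congr rfl fun a _ => ?_
        rw [Finset.sum_comm]
        refine Finset.sum_congr rfl fun a' _ => ?_
        simp only [Finset.mul_sum]
    _ ≤ ∑ a, ∑ b, (S.w a * (if A a then 1 else 0)) * ((S'.w b * (if B b then 1 else 0)) * X) :=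
        Finset.sum_le_sum fun a _ => Finset.sum_le_sum fun b _ => h2 a b
    _ = _ := by
        rw [← hA, ← hB, Finset.sum_mul_sum, Finset.sum_mul]
        refine Finset.sum_congr rfl fun a _ => ?_
        rw [Finset.sum_mul]
        refine Finset.sum_congr rfl fun b _ => ?_
        ring

section core
variable {β γ : Type*} [Fintype β] [Fintype γ] {c c' : ℕ} (S : TsSampler β c)
    (S' : TsSampler γ c') {K K' : ℕ}

def tsE (f : (Fin K → Fin S.N) → (Fin K' → Fin S'.N) → ℝ) : ℝ :=
  ∑ s, ∑ r, S.pr s * S'.pr r * f s r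

lemma tsE_mono (f g : (Fin K → Fin S.N) → (Fin K' → Fin S'.N) → ℝ) (h : ∀ s r, f s r ≤ g s r) :
    tsE S S' f ≤ tsE S S' g :=
  Finset.sum_le_sum fun s _ => Finset.sum_le_sum fun r _ =>
    mul_le_mul_of_nonneg_left (h s r) (mul_nonneg (S.pr0 s) (S'.pr0 r))

lemma tsE_add (f g : (Fin K → Fin S.N) → (Fin K' → Fin S'.N) → ℝ) :
    tsE S S' (fun s r => f s r + g s r) = tsE S S' f + tsE S S' g := by
  simp [tsE, mul_add, Finset.sum_add_distrib]

lemma tsE_sub (f g : (Fin K → Fin S.N) → (Fin K' → Fin S'.N) → ℝ) :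
    tsE S S' (fun s r => f s r - g s r) = tsE S S' f - tsE S S' g := by
  simp [tsE, mul_sub, Finset.sum_sub_distrib]

lemma tsE_sum {ι : Type*} [Fintype ι] (f : ι → (Fin K → Fin S.N) → (Fin K' → Fin S'.N) → ℝ) :
    tsE S S' (fun s r => ∑ i, f i s r) = ∑ i, tsE S S' (f i) := by
  simp only [tsE, Finset.mul_sum]
  calc _ = ∑ s, ∑ i, ∑ r, S.pr s * S'.pr r * f i s r :=
        Finset.sum_congr rfl fun s _ => Finset.sum_comm
    _ = _ := Finset.sum_comm

lemma tsE_zero : tsE S S' (fun (_ : Fin K → Fin S.N) (_ : Fin K' → Fin S'.N) => 0) = 0 := by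
  simp [tsE]

lemma tsE_mul (f : (Fin K → Fin S.N) → ℝ) (g : (Fin K' → Fin S'.N) → ℝ) :
    tsE S S' (fun s r => f s * g r) = (∑ s, S.pr s * f s) * (∑ r, S'.pr r * g r) := by
  rw [tsE, Finset.sum_mul_sum]
  exact Finset.sum_congr rfl fun s _ => Finset.sum_congr rfl fun r _ => by ring

lemma tsE_one : tsE S S' (fun (_ : Fin K → Fin S.N) (_ : Fin K' → Fin S'.N) => 1) = 1 := by
  have h := tsE_mul S S' (K := K) (K' := K') (fun _ => 1) (fun _ => 1)
  simp only [mul_one] at h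
  rw [h]
  simp only [TsSampler.pr]
  rw [ts_E0 K S.w S.w1, ts_E0 K' S'.w S'.w1]; norm_num

def tsCand (t1 t2 t3 : β → γ → ℝ) (a : Fin S.N) (b : Fin S'.N) : Prop :=
  S.uu a ≤ t1 (S.mm a) (S'.mm b) ∧ S'.uu b ≤ t2 (S.mm a) (S'.mm b) ∧
    S.uu a * S'.uu b ≤ t3 (S.mm a) (S'.mm b)

def tsUniq (t1 t2 t3 : β → γ → ℝ) (s : Fin K → Fin S.N) (r : Fin K' → Fin S'.N)
    (i : Fin K) (j : Fin K') : Prop :=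
  ∀ i' j', S.hh (s i') = S.hh (s i) → S'.hh (r j') = S'.hh (r j) →
    tsCand S S' t1 t2 t3 (s i') (r j') → i' = i ∧ j' = j

lemma ts_coll (A : Fin S.N → Prop) (B : Fin S'.N → Prop) (qA qB : ℝ) (hqA : 0 ≤ qA) (hqB : 0 ≤ qB)
    (hA : ∑ a, S.w a * (if A a then 1 else 0) = qA)
    (hB : ∑ a, S'.w a * (if B a then 1 else 0) = qB)
    (t1 t2 t3 : β → γ → ℝ) (ht1 : ∀ m n, 0 ≤ t1 m n) (ht2 : ∀ m n, 0 ≤ t2 m n)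
    (T1 T2 X : ℝ) (hT1 : ∀ n, ∑ m, t1 m n ≤ T1)
    (hT2 : ∀ m, ∑ n, t2 m n ≤ T2) (hT10 : 0 ≤ T1) (hT20 : 0 ≤ T2) (hX0 : 0 ≤ X)
    (hX : ∀ h h', ∑ a, ∑ b, S.w a * S'.w b * (if S.hh a = h ∧ S'.hh b = h' ∧
        S.uu a * S'.uu b ≤ t3 (S.mm a) (S'.mm b) then 1 else 0) ≤ X) :
    tsE S S' (fun (s : Fin K → Fin S.N) (r : Fin K' → Fin S'.N) => ∑ i, ∑ j,
      (if A (s i) ∧ B (r j) ∧ ¬ tsUniq S S' t1 t2 t3 s r i j then 1 else 0)) ≤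
    K * K' * (K * (qA * qB * (T1 / (Fintype.card β * c))) +
      K' * (qA * qB * (T2 / (Fintype.card γ * c'))) + K * K' * (qA * qB * X)) := by
  rw [tsE_sum]
  simp_rw [tsE_sum]
  suffices h : ∀ i : Fin K, ∀ j : Fin K', tsE S S' (fun s r =>
      (if A (s i) ∧ B (r j) ∧ ¬ tsUniq S S' t1 t2 t3 s r i j then 1 else 0)) ≤
      (K * (qA * qB * (T1 / (Fintype.card β * c))) +
      K' * (qA * qB * (T2 / (Fintype.card γ * c'))) + K * K' * (qA * qB * X)) by
    refine (Finset.sum_le_sum fun i _ => Finset.sum_le_sum fun j _ => h i j).trans ?_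
    simp only [Finset.sum_const, Finset.card_univ, Fintype.card_fin, nsmul_eq_mul]
    exact (mul_assoc _ _ _).ge
  intro i j
  let F1 : Fin K → (Fin K → Fin S.N) → (Fin K' → Fin S'.N) → ℝ := fun i' s r =>
    if i' ≠ i then (if A (s i) ∧ B (r j) ∧ S.hh (s i') = S.hh (s i) ∧
        S.uu (s i') ≤ t1 (S.mm (s i')) (S'.mm (r j)) then 1 else 0) else 0
  let F2 : Fin K' → (Fin K → Fin S.N) → (Fin K' → Fin S'.N) → ℝ := fun j' s r =>
    if j' ≠ j then (if B (r j) ∧ A (s i) ∧ S'.hh (r j') = S'.hh (r j) ∧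
        S'.uu (r j') ≤ t2 (S.mm (s i)) (S'.mm (r j')) then 1 else 0) else 0
  let F3 : Fin K → Fin K' → (Fin K → Fin S.N) → (Fin K' → Fin S'.N) → ℝ := fun i' j' s r =>
    if i' ≠ i ∧ j' ≠ j then (if A (s i) ∧ B (r j) ∧ S.hh (s i') = S.hh (s i) ∧
      S'.hh (r j') = S'.hh (r j) ∧
        S.uu (s i') * S'.uu (r j') ≤ t3 (S.mm (s i')) (S'.mm (r j')) then 1 else 0) else 0
  have hF1 : ∀ i' s r, 0 ≤ F1 i' s r := by
    intro i' s r; simp only [F1]; split_ifs <;> norm_num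
  have hF2 : ∀ i' s r, 0 ≤ F2 i' s r := by
    intro i' s r; simp only [F2]; split_ifs <;> norm_num
  have hF3 : ∀ i' j' s r, 0 ≤ F3 i' j' s r := by
    intro i' j' s r; simp only [F3]; split_ifs <;> norm_num
  have hpt : ∀ s r, (if A (s i) ∧ B (r j) ∧ ¬ tsUniq S S' t1 t2 t3 s r i j then (1:ℝ) else 0) ≤
      ((∑ i', F1 i' s r) + ∑ j', F2 j' s r) + ∑ i', ∑ j', F3 i' j' s r := by
    intro s r
    have n1 : 0 ≤ ∑ i', F1 i' s r := Finset.sum_nonneg fun i' _ => hF1 i' s r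
    have n2 : 0 ≤ ∑ i', F2 i' s r := Finset.sum_nonneg fun i' _ => hF2 i' s r
    have n3' : ∀ i', 0 ≤ ∑ j', F3 i' j' s r := fun i' => Finset.sum_nonneg fun j' _ => hF3 i' j' s r
    have n3 : 0 ≤ ∑ i', ∑ j', F3 i' j' s r := Finset.sum_nonneg fun i' _ => n3' i'
    split_ifs with h
    · obtain ⟨hAi, hBj, hu⟩ := h
      simp only [tsUniq] at hu
      push Not at hu
      obtain ⟨i', j', e1, e2, ⟨c1, c2, c3⟩, hne⟩ := hu
      by_cases hi : i' = i
      · have hj := hne hi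
        subst hi
        have : F2 j' s r = 1 := by
          simp only [F2]; rw [if_pos hj, if_pos ⟨hBj, hAi, e2, c2⟩]
        have := Finset.single_le_sum (fun k _ => hF2 k s r) (Finset.mem_univ j')
        linarith
      · by_cases hj : j' = j
        · subst hj
          have : F1 i' s r = 1 := by
            simp only [F1]; rw [if_pos hi, if_pos ⟨hAi, hBj, e1, c1⟩]
          have := Finset.single_le_sum (fun k _ => hF1 k s r) (Finset.mem_univ i')
          linarith
        · have : F3 i' j' s r = 1 := by
            simp only [F3]; rw [if_pos ⟨hi, hj⟩, if_pos ⟨hAi, hBj, e1, e2, c3⟩]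
          have h1 := Finset.single_le_sum (fun k _ => hF3 i' k s r) (Finset.mem_univ j')
          have h2 := Finset.single_le_sum (fun k _ => n3' k) (Finset.mem_univ i')
          linarith
    · linarith
  refine (tsE_mono S S' _ _ hpt).trans ?_
  rw [tsE_add, tsE_add, tsE_sum, tsE_sum, tsE_sum]
  simp_rw [tsE_sum]
  have b1 : ∀ i', tsE S S' (F1 i') ≤ qA * qB * (T1 / (Fintype.card β * c)) := by
    intro i'
    by_cases hi : i' ≠ i
    · refine le_trans (le_of_eq ?_) (ts_coll1 S S' A B qA qB hA hB t1 ht1 T1 hT1 i i' j hi)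
      simp only [F1, if_pos hi, tsE]
    · simp only [F1, if_neg hi, tsE_zero]; positivity
  have b2 : ∀ j', tsE S S' (F2 j') ≤ qA * qB * (T2 / (Fintype.card γ * c')) := by
    intro j'
    by_cases hj : j' ≠ j
    · have := ts_coll1 S' S B A qB qA hB hA (fun n m => t2 m n) (fun n m => ht2 m n) T2 hT2 j j' i hj
      rw [mul_comm qA qB]
      refine le_trans (le_of_eq ?_) this
      rw [Finset.sum_comm]
      simp only [F2, if_pos hj, tsE]
      refine Finset.sum_congr rfl fun s _ => Finset.sum_congr rfl fun r _ => ?_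
      rw [mul_comm (S.pr _)]
    · simp only [F2, if_neg hj, tsE_zero]; positivity
  have b3 : ∀ i' j', tsE S S' (F3 i' j') ≤ qA * qB * X := by
    intro i' j'
    by_cases hj : i' ≠ i ∧ j' ≠ j
    · refine le_trans (le_of_eq ?_) (ts_coll2 S S' A B qA qB hA hB t3 X hX i i' j j' hj.1 hj.2)
      simp only [F3, if_pos hj, tsE]
    · simp only [F3, if_neg hj, tsE_zero]; positivity
  refine add_le_add (add_le_add ?_ ?_) ?_
  · refine (Finset.sum_le_sum fun i' _ => b1 i').trans (le_of_eq ?_)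
    simp
  · refine (Finset.sum_le_sum fun i' _ => b2 i').trans (le_of_eq ?_)
    simp
  · refine (Finset.sum_le_sum fun i' _ => Finset.sum_le_sum fun j' _ => b3 i' j').trans
      (le_of_eq ?_)
    simp [mul_assoc]

def tsEnc (A : Fin S.N → Prop) (c0 : Fin c) (s : Fin K → Fin S.N) : Fin c :=
  if h : ∃ i, tsFst A s i then S.hh (s h.choose) else c0

lemma tsEnc_eq (A : Fin S.N → Prop) (c0 : Fin c) (s : Fin K → Fin S.N) (i : Fin K)
    (hi : tsFst A s i) : tsEnc S A c0 s = S.hh (s i) := by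
  have h : ∃ i, tsFst A s i := ⟨i, hi⟩
  rw [tsEnc, dif_pos h, tsFst_unique A s _ _ h.choose_spec hi]

def tsDec (t1 t2 t3 : β → γ → ℝ) (d0 : β × γ) (h : Fin c) (h' : Fin c') (s : Fin K → Fin S.N)
    (r : Fin K' → Fin S'.N) : β × γ :=
  if H : ∃ q : Fin K × Fin K', S.hh (s q.1) = h ∧ S'.hh (r q.2) = h' ∧
      tsCand S S' t1 t2 t3 (s q.1) (r q.2)
  then (S.mm (s H.choose.1), S'.mm (r H.choose.2)) else d0

def tsV (A : Fin S.N → Prop) (B : Fin S'.N → Prop) (t1 t2 t3 : β → γ → ℝ) (T : β → γ → Prop)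
    (m : β) (n : γ) (s : Fin K → Fin S.N) (r : Fin K' → Fin S'.N) : ℝ :=
  ∑ i, ∑ j, (if (tsFst A s i ∧ S.mm (s i) = m) ∧ (tsFst B r j ∧ S'.mm (r j) = n) ∧ T m n ∧
    tsUniq S S' t1 t2 t3 s r i j then 1 else 0)

lemma tsV_nonneg (A : Fin S.N → Prop) (B : Fin S'.N → Prop) (t1 t2 t3 : β → γ → ℝ)
    (T : β → γ → Prop)
    (m : β) (n : γ) (s : Fin K → Fin S.N) (r : Fin K' → Fin S'.N) :
    0 ≤ tsV S S' A B t1 t2 t3 T m n s r :=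
  Finset.sum_nonneg fun _ _ => Finset.sum_nonneg fun _ _ => by split_ifs <;> norm_num

lemma tsV_le_dec (P : β → ℝ) (Q : γ → ℝ) (hP : ∀ m, 0 ≤ P m)
    (t1 t2 t3 : β → γ → ℝ) (T : β → γ → Prop)
    (hT : ∀ m n, T m n → P m ≤ t1 m n ∧ Q n ≤ t2 m n ∧ P m * Q n ≤ t3 m n)
    (d0 : β × γ) (c0 : Fin c) (c0' : Fin c')
    (m : β) (n : γ) (s : Fin K → Fin S.N) (r : Fin K' → Fin S'.N) :
    tsV S S' (S.acc P) (S'.acc Q) t1 t2 t3 T m n s r ≤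
      (if tsDec S S' t1 t2 t3 d0 (tsEnc S (S.acc P) c0 s) (tsEnc S' (S'.acc Q) c0' r) s r = (m, n)
        then 1 else 0) := by
  by_cases h : ∃ i j, (tsFst (S.acc P) s i ∧ S.mm (s i) = m) ∧
      (tsFst (S'.acc Q) r j ∧ S'.mm (r j) = n) ∧ T m n ∧ tsUniq S S' t1 t2 t3 s r i j
  · obtain ⟨i, j, ⟨hi, him⟩, ⟨hj, hjn⟩, hTmn, hu⟩ := h
    have hV : tsV S S' (S.acc P) (S'.acc Q) t1 t2 t3 T m n s r ≤ 1 := by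
      rw [tsV, Finset.sum_eq_single i, Finset.sum_eq_single j]
      · split_ifs <;> norm_num
      · intro j' _ hj'
        rw [if_neg]
        exact fun hc => hj' (tsFst_unique _ _ _ _ hc.2.1.1 hj)
      · simp
      · intro i' _ hi'
        refine Finset.sum_eq_zero fun j' _ => ?_
        rw [if_neg]
        exact fun hc => hi' (tsFst_unique _ _ _ _ hc.1.1 hi)
      · simp
    rw [if_pos]
    · exact hV
    rw [tsEnc_eq S _ c0 s i hi, tsEnc_eq S' _ c0' r j hj]
    have hai : S.uu (s i) ≤ P m := by have := hi.1; rwa [TsSampler.acc, him] at this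
    have hbj : S'.uu (r j) ≤ Q n := by have := hj.1; rwa [TsSampler.acc, hjn] at this
    obtain ⟨k1, k2, k3⟩ := hT m n hTmn
    have hcand : tsCand S S' t1 t2 t3 (s i) (r j) := by
      refine ⟨?_, ?_, ?_⟩ <;> rw [him, hjn]
      · exact hai.trans k1
      · exact hbj.trans k2
      · exact (mul_le_mul hai hbj (S'.u0 _) (hP m)).trans k3
    have H : ∃ q : Fin K × Fin K', S.hh (s q.1) = S.hh (s i) ∧ S'.hh (r q.2) = S'.hh (r j) ∧
      tsCand S S' t1 t2 t3 (s q.1) (r q.2) := ⟨(i, j), rfl, rfl, hcand⟩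
    rw [tsDec, dif_pos H]
    have hs := H.choose_spec
    obtain ⟨e1, e2⟩ := hu _ _ hs.1 hs.2.1 hs.2.2
    rw [e1, e2, him, hjn]
  · have : tsV S S' (S.acc P) (S'.acc Q) t1 t2 t3 T m n s r = 0 := by
      refine Finset.sum_eq_zero fun i _ => Finset.sum_eq_zero fun j _ => ?_
      rw [if_neg]
      exact fun hc => h ⟨i, j, hc⟩
    rw [this]
    split_ifs <;> norm_num

end core

/-- acceptance facts -/
lemma ts_acc {β : Type*} [Fintype β] {c : ℕ} (S : TsSampler β c) (P : β → ℝ)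
    (hacc : ∀ m, ∑ a, S.w a * (if S.uu a ≤ P m ∧ S.mm a = m then 1 else 0)
      = P m / Fintype.card β) (m : β) :
    ∑ a, S.w a * (if S.acc P a ∧ S.mm a = m then 1 else 0) = P m / Fintype.card β := by
  rw [← hacc m]
  refine Finset.sum_congr rfl fun a _ => ?_
  congr 1
  refine if_congr ?_ rfl rfl
  rw [TsSampler.acc]
  constructor
  · rintro ⟨h1, rfl⟩; exact ⟨h1, rfl⟩
  · rintro ⟨h1, rfl⟩; exact ⟨h1, rfl⟩

lemma ts_acc_tot {β : Type*} [Fintype β] {c : ℕ} (S : TsSampler β c) (P : β → ℝ)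
    (hP1 : ∑ m, P m = 1)
    (hacc : ∀ m, ∑ a, S.w a * (if S.uu a ≤ P m ∧ S.mm a = m then 1 else 0)
      = P m / Fintype.card β) :
    ∑ a, S.w a * (if S.acc P a then 1 else 0) = 1 / Fintype.card β := by
  have h1 : 1 / (Fintype.card β : ℝ) = ∑ m, P m / Fintype.card β := by
    rw [← Finset.sum_div, hP1]
  rw [h1]
  simp_rw [← ts_acc S P hacc]
  rw [Finset.sum_comm]
  refine Finset.sum_congr rfl fun a _ => ?_
  rw [← Finset.mul_sum]
  congr 1
  by_cases h : S.acc P a <;> simp [h]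

lemma ts_fst {β : Type*} [Fintype β] [Nonempty β] {c : ℕ} (S : TsSampler β c) (P : β → ℝ)
    (hP1 : ∑ m, P m = 1)
    (hacc : ∀ m, ∑ a, S.w a * (if S.uu a ≤ P m ∧ S.mm a = m then 1 else 0)
      = P m / Fintype.card β) (K : ℕ) (m : β) :
    ∑ s : Fin K → Fin S.N, S.pr s * ∑ i, (if tsFst (S.acc P) s i ∧ S.mm (s i) = m then 1 else 0)
      = P m * (1 - (1 - 1 / Fintype.card β)^K) := by
  have hc : (Fintype.card β : ℝ) ≠ 0 := by exact_mod_cast Fintype.card_ne_zero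
  have h := ts_Efst K S.w S.w1 (S.acc P) (fun a => S.mm a = m) _ _ (ts_acc_tot S P hP1 hacc)
    (ts_acc S P hacc m) (one_div_ne_zero hc)
  refine Eq.trans ?_ (h.trans ?_)
  · rfl
  · congr 1; field_simp

lemma ts_fail (M D K : ℕ) (hM : 0 < M) (hK : K = D * M) (δ : ℝ) (hδ : 0 < δ) (hD : (D:ℝ) = 1 / δ) :
    0 ≤ (1 - 1 / (M:ℝ))^K ∧ (1 - 1 / (M:ℝ))^K ≤ δ := by
  have hM' : (1:ℝ) ≤ M := by exact_mod_cast hM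
  have h0 : 0 ≤ 1 - 1 / (M:ℝ) := by
    rw [sub_nonneg, div_le_one (by linarith)]; exact hM'
  refine ⟨pow_nonneg h0 K, ?_⟩
  have h1 : 1 - 1 / (M:ℝ) ≤ Real.exp (-(1 / (M:ℝ))) := Real.one_sub_le_exp_neg _
  calc (1 - 1 / (M:ℝ))^K ≤ (Real.exp (-(1 / (M:ℝ))))^K := pow_le_pow_left₀ h0 h1 K
    _ = Real.exp (-(D:ℝ)) := by
        rw [← Real.exp_nat_mul]; congr 1; rw [hK]; push_cast
        field_simp
    _ ≤ δ := by
        rw [Real.exp_neg, hD]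
        have := Real.add_one_le_exp (1 / δ)
        have h2 : 1 / δ ≤ Real.exp (1 / δ) := by linarith
        calc (Real.exp (1 / δ))⁻¹ ≤ (1 / δ)⁻¹ := inv_anti₀ (by positivity) h2
          _ = δ := by simp

section core2
variable {β γ : Type*} [Fintype β] [Fintype γ] [Nonempty β] [Nonempty γ] {c c' : ℕ}
    (S : TsSampler β c) (S' : TsSampler γ c') {K K' : ℕ}

lemma ts_core_upper (P : β → ℝ) (Q : γ → ℝ) (hP : ∀ m, 0 ≤ P m) (hQ : ∀ n, 0 ≤ Q n)
    (hP1 : ∑ m, P m = 1) (hQ1 : ∑ n, Q n = 1)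
    (haccP : ∀ m, ∑ a, S.w a * (if S.uu a ≤ P m ∧ S.mm a = m then 1 else 0)
      = P m / Fintype.card β)
    (haccQ : ∀ m, ∑ a, S'.w a * (if S'.uu a ≤ Q m ∧ S'.mm a = m then 1 else 0)
      = Q m / Fintype.card γ)
    (hf : 0 ≤ (1 - 1 / (Fintype.card β : ℝ))^K) (hf' : 0 ≤ (1 - 1 / (Fintype.card γ : ℝ))^K')
    (t1 t2 t3 : β → γ → ℝ) (T : β → γ → Prop) (m : β) (n : γ) :
    tsE S S' (fun (s : Fin K → Fin S.N) (r : Fin K' → Fin S'.N) =>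
      tsV S S' (S.acc P) (S'.acc Q) t1 t2 t3 T m n s r) ≤ P m * Q n := by
  have h1 := tsE_mul S S' (fun s : Fin K → Fin S.N =>
    ∑ i, (if tsFst (S.acc P) s i ∧ S.mm (s i) = m then (1:ℝ) else 0))
    (fun s : Fin K' → Fin S'.N =>
    ∑ i, (if tsFst (S'.acc Q) s i ∧ S'.mm (s i) = n then (1:ℝ) else 0))
  rw [ts_fst S P hP1 haccP, ts_fst S' Q hQ1 haccQ] at h1
  refine (tsE_mono S S' _ _ ?_).trans (h1.le.trans ?_)
  · intro s r
    rw [Finset.sum_mul_sum, tsV]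
    refine Finset.sum_le_sum fun i _ => Finset.sum_le_sum fun j _ => ?_
    by_cases hA : tsFst (S.acc P) s i ∧ S.mm (s i) = m
    · by_cases hB : tsFst (S'.acc Q) r j ∧ S'.mm (r j) = n
      · rw [if_pos hA, if_pos hB]; split_ifs <;> norm_num
      · rw [if_neg hB, if_neg (fun h => hB h.2.1)]; simp
    · rw [if_neg hA, if_neg (fun h => hA h.1)]; simp
  · have h3 : (∑ x : β, P x) * (1 - (1 - 1 / (Fintype.card β : ℝ))^K) =
      ∑ s : Fin K → Fin S.N, S.pr s * ∑ m, ∑ i,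
        (if tsFst (S.acc P) s i ∧ S.mm (s i) = m then 1 else 0) := by
      simp only [Finset.mul_sum, Finset.sum_mul]
      rw [Finset.sum_comm]
      refine Finset.sum_congr rfl fun x _ => ?_
      rw [← ts_fst S P hP1 haccP]
      simp only [Finset.mul_sum]
    have h3' : (∑ x : γ, Q x) * (1 - (1 - 1 / (Fintype.card γ : ℝ))^K') =
      ∑ s : Fin K' → Fin S'.N, S'.pr s * ∑ m, ∑ i,
        (if tsFst (S'.acc Q) s i ∧ S'.mm (s i) = m then 1 else 0) := by
      simp only [Finset.mul_sum, Finset.sum_mul]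
      rw [Finset.sum_comm]
      refine Finset.sum_congr rfl fun x _ => ?_
      rw [← ts_fst S' Q hQ1 haccQ]
      simp only [Finset.mul_sum]
    have h4 : 0 ≤ 1 - (1 - 1 / (Fintype.card γ : ℝ))^K' := by
      rw [hQ1, one_mul] at h3'
      rw [h3']
      exact Finset.sum_nonneg fun s _ => mul_nonneg (S'.pr0 s) (Finset.sum_nonneg fun _ _ =>
        Finset.sum_nonneg fun _ _ => by split_ifs <;> norm_num)
    refine mul_le_mul ?_ ?_ (mul_nonneg (hQ n) h4) (hP m)
    · exact mul_le_of_le_one_right (hP m) (by linarith)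
    · exact mul_le_of_le_one_right (hQ n) (by linarith)

lemma ts_core_lower (P : β → ℝ) (Q : γ → ℝ) (hP : ∀ m, 0 ≤ P m) (hQ : ∀ n, 0 ≤ Q n)
    (hP1 : ∑ m, P m = 1) (hQ1 : ∑ n, Q n = 1)
    (haccP : ∀ m, ∑ a, S.w a * (if S.uu a ≤ P m ∧ S.mm a = m then 1 else 0)
      = P m / Fintype.card β)
    (haccQ : ∀ m, ∑ a, S'.w a * (if S'.uu a ≤ Q m ∧ S'.mm a = m then 1 else 0)
      = Q m / Fintype.card γ) (δ CB : ℝ)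
    (hf : 0 ≤ (1 - 1 / (Fintype.card β : ℝ))^K ∧ (1 - 1 / (Fintype.card β : ℝ))^K ≤ δ)
    (hf' : 0 ≤ (1 - 1 / (Fintype.card γ : ℝ))^K' ∧ (1 - 1 / (Fintype.card γ : ℝ))^K' ≤ δ)
    (t1 t2 t3 : β → γ → ℝ) (T : β → γ → Prop)
    (hCB : tsE S S' (fun (s : Fin K → Fin S.N) (r : Fin K' → Fin S'.N) => ∑ i, ∑ j,
      (if (S.acc P) (s i) ∧ (S'.acc Q) (r j) ∧ ¬ tsUniq S S' t1 t2 t3 s r i j then 1 else 0)) ≤ CB) :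
    (∑ m, ∑ n, (if T m n then P m * Q n else 0)) - 2 * δ - CB ≤
    ∑ m, ∑ n, tsE S S' (fun (s : Fin K → Fin S.N) (r : Fin K' → Fin S'.N) =>
      tsV S S' (S.acc P) (S'.acc Q) t1 t2 t3 T m n s r) := by
  let FA : β → (Fin K → Fin S.N) → ℝ := fun m s =>
    ∑ i, (if tsFst (S.acc P) s i ∧ S.mm (s i) = m then (1:ℝ) else 0)
  let FB : γ → (Fin K' → Fin S'.N) → ℝ := fun n s =>
    ∑ i, (if tsFst (S'.acc Q) s i ∧ S'.mm (s i) = n then (1:ℝ) else 0)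
  set f := (1 - 1 / (Fintype.card β : ℝ))^K with hfdef
  set f' := (1 - 1 / (Fintype.card γ : ℝ))^K' with hfdef'
  have h1 : ∀ m n, tsE S S' (fun s r => FA m s * FB n r) = (P m * (1 - f)) * (Q n * (1 - f')) := by
    intro m n
    rw [tsE_mul, ts_fst S P hP1 haccP, ts_fst S' Q hQ1 haccQ]
  -- pointwise
  have hpt : ∀ (s : Fin K → Fin S.N) (r : Fin K' → Fin S'.N),
      (∑ m, ∑ n, (if T m n then 1 else 0) * (FA m s * FB n r)) ≤
      (∑ m, ∑ n, tsV S S' (S.acc P) (S'.acc Q) t1 t2 t3 T m n s r) + ∑ i, ∑ j,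
      (if (S.acc P) (s i) ∧ (S'.acc Q) (r j) ∧ ¬ tsUniq S S' t1 t2 t3 s r i j then 1 else 0) := by
    intro s r
    have e1 : ∑ m, ∑ n, ∑ i, ∑ j, (if (tsFst (S.acc P) s i ∧ S.mm (s i) = m) ∧
        (tsFst (S'.acc Q) r j ∧ S'.mm (r j) = n) ∧ ¬ tsUniq S S' t1 t2 t3 s r i j then (1:ℝ) else 0)
        ≤ ∑ i, ∑ j,
      (if (S.acc P) (s i) ∧ (S'.acc Q) (r j) ∧ ¬ tsUniq S S' t1 t2 t3 s r i j then 1 else 0) := by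
      have hsw : ∀ F : β → γ → Fin K → Fin K' → ℝ, ∑ m, ∑ n, ∑ i, ∑ j, F m n i j =
          ∑ i, ∑ j, ∑ m, ∑ n, F m n i j := by
        intro F
        calc _ = ∑ a, ∑ m, ∑ b, ∑ n, F a b m n := Finset.sum_congr rfl fun a _ => Finset.sum_comm
          _ = ∑ m, ∑ a, ∑ b, ∑ n, F a b m n := Finset.sum_comm
          _ = ∑ m, ∑ a, ∑ n, ∑ b, F a b m n := Finset.sum_congr rfl fun a _ =>
              Finset.sum_congr rfl fun b _ => Finset.sum_comm
          _ = _ := Finset.sum_congr rfl fun a _ => Finset.sum_comm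
      rw [hsw]
      refine Finset.sum_le_sum fun i _ => Finset.sum_le_sum fun j _ => ?_
      rw [Finset.sum_eq_single (S.mm (s i)), Finset.sum_eq_single (S'.mm (r j))]
      · by_cases h : (tsFst (S.acc P) s i ∧ S.mm (s i) = S.mm (s i)) ∧
          (tsFst (S'.acc Q) r j ∧ S'.mm (r j) = S'.mm (r j)) ∧ ¬ tsUniq S S' t1 t2 t3 s r i j
        · rw [if_pos h, if_pos ⟨h.1.1.1, h.2.1.1.1, h.2.2⟩]
        · rw [if_neg h]; split_ifs <;> norm_num
      · intro n _ hn; rw [if_neg]; exact fun h => hn h.2.1.2.symm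
      · simp
      · intro m _ hm; refine Finset.sum_eq_zero fun n _ => ?_
        rw [if_neg]; exact fun h => hm h.1.2.symm
      · simp
    refine le_trans ?_ (add_le_add_right e1 _)
    simp only [← Finset.sum_add_distrib]
    refine Finset.sum_le_sum fun m _ => Finset.sum_le_sum fun n _ => ?_
    simp only [FA, FB, tsV]
    rw [Finset.sum_mul_sum, Finset.mul_sum]
    simp only [← Finset.sum_add_distrib, Finset.mul_sum]
    refine Finset.sum_le_sum fun i _ => Finset.sum_le_sum fun j _ => ?_
    by_cases hA : tsFst (S.acc P) s i ∧ S.mm (s i) = m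
    · by_cases hB : tsFst (S'.acc Q) r j ∧ S'.mm (r j) = n
      · by_cases hTT : T m n <;> by_cases hU : tsUniq S S' t1 t2 t3 s r i j <;>
          simp [hA, hB, hTT, hU]
      · rw [if_neg hB]; simp only [mul_zero]
        refine add_nonneg ?_ ?_ <;> split_ifs <;> norm_num
    · rw [if_neg hA]; simp only [mul_zero, zero_mul]
      refine add_nonneg ?_ ?_ <;> split_ifs <;> norm_num
  have h2 := tsE_mono S S' _ _ hpt
  rw [tsE_add, tsE_sum, tsE_sum] at h2
  simp_rw [tsE_sum S S' (ι := γ)] at h2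
  have h3 : ∀ m n, tsE S S' (fun s r => (if T m n then 1 else 0) * (FA m s * FB n r)) =
      (if T m n then P m * Q n else 0) * ((1 - f) * (1 - f')) := by
    intro m n
    by_cases hTT : T m n
    · simp only [hTT, if_true, one_mul]
      rw [h1]; ring
    · simp only [hTT, if_false, zero_mul, tsE_zero]
  simp_rw [h3, ← Finset.sum_mul] at h2
  have h4 : ∑ m, ∑ n, (if T m n then P m * Q n else 0) ≤ 1 := by
    calc _ ≤ ∑ m, ∑ n, P m * Q n := by
          refine Finset.sum_le_sum fun m _ => Finset.sum_le_sum fun n _ => ?_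
          split_ifs
          · exact le_rfl
          · exact mul_nonneg (hP m) (hQ n)
      _ = 1 := by rw [← Finset.sum_mul_sum, hP1, hQ1, one_mul]
  have h5 : 0 ≤ ∑ m, ∑ n, (if T m n then P m * Q n else 0) :=
    Finset.sum_nonneg fun m _ => Finset.sum_nonneg fun n _ => by
      split_ifs
      · exact mul_nonneg (hP m) (hQ n)
      · exact le_rfl
  set σ := ∑ m, ∑ n, (if T m n then P m * Q n else 0)
  have h6 : σ - 2 * δ ≤ σ * ((1 - f) * (1 - f')) := by
    have : 0 ≤ σ * (f * f') := mul_nonneg h5 (mul_nonneg hf.1 hf'.1)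
    have h7 : σ * f ≤ f := mul_le_of_le_one_left hf.1 h4
    have h8 : σ * f' ≤ f' := mul_le_of_le_one_left hf'.1 h4
    nlinarith [hf.2, hf'.2]
  linarith

end core2

/-- transport of the shared randomness to `Fin` -/
lemma ts_scheme_of_fintype {𝒳 𝒴 𝒵 ℳ 𝒩 : Type*} [Fintype 𝒳] [Fintype 𝒴] [Fintype 𝒵] [Fintype ℳ]
    [Fintype 𝒩] (p : 𝒳 → 𝒴 → 𝒵 → ℳ → 𝒩 → ℝ) (R₁ R₂ ε : ℝ) (ΩA ΩB : Type) [Fintype ΩA] [Fintype ΩB]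
    (cA cB : ℕ) (qA : ΩA → ℝ) (qB : ΩB → ℝ)
    (fA : 𝒳 → ΩA → Fin cA) (fB : 𝒴 → ΩB → Fin cB)
    (g : Fin cA → Fin cB → 𝒵 → ΩA → ΩB → ℳ × 𝒩)
    (h1 : ∀ s, 0 ≤ qA s) (h2 : (∑ s, qA s) = 1)
    (h3 : ∀ s, 0 ≤ qB s) (h4 : (∑ s, qB s) = 1)
    (h5 : (cA : ℝ) ≤ (2 : ℝ) ^ (⌈R₁⌉ : ℤ)) (h6 : (cB : ℝ) ≤ (2 : ℝ) ^ (⌈R₂⌉ : ℤ))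
    (h7 : (1 / 2) * (∑ x, ∑ y, ∑ z, ∑ m, ∑ n,
      |margXYZ p x y z * (∑ sa, ∑ sb, qA sa * qB sb *
          (if g (fA x sa) (fB y sb) z sa sb = (m, n) then 1 else 0)) - p x y z m n|) ≤ ε) :
    IsTwoSenderScheme p R₁ R₂ ε := by
  let eA := Fintype.equivFin ΩA
  let eB := Fintype.equivFin ΩB
  refine ⟨_, _, cA, cB, fun s => qA (eA.symm s), fun s => qB (eB.symm s),
    fun x s => fA x (eA.symm s), fun y s => fB y (eB.symm s),
    fun a b z s r => g a b z (eA.symm s) (eB.symm r), fun s => h1 _, ?_, fun s => h3 _, ?_, h5, h6, ?_⟩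
  · rw [eA.symm.sum_comp qA, h2]
  · rw [eB.symm.sum_comp qB, h4]
  · refine le_trans (le_of_eq ?_) h7
    congr 1
    refine Finset.sum_congr rfl fun x _ => Finset.sum_congr rfl fun y _ =>
      Finset.sum_congr rfl fun z _ => Finset.sum_congr rfl fun m _ =>
      Finset.sum_congr rfl fun n _ => ?_
    congr 2
    rw [eA.symm.sum_comp (fun sa => ∑ sb, qA sa * qB (eB.symm sb) * margXYZ p x y z *
      (if g (fA x sa) (fB y (eB.symm sb)) z sa (eB.symm sb) = (m, n) then 1 else 0)), Finset.mul_sum]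
    refine Finset.sum_congr rfl fun sa _ => ?_
    rw [eB.symm.sum_comp (fun sb => qA sa * qB sb * margXYZ p x y z *
      (if g (fA x sa) (fB y sb) z sa sb = (m, n) then 1 else 0)), Finset.mul_sum]
    refine Finset.sum_congr rfl fun sb _ => ?_
    ring

lemma ts_rate (δ R : ℝ) (hδ0 : 0 < δ) (hδ1 : δ < 1) (hR : 0 ≤ R) :
    ∃ c : ℕ, 0 < c ∧ (c : ℝ) ≤ (2 : ℝ) ^ (⌈R + 3 * logb 2 (1 / δ)⌉ : ℤ) ∧
      (2 : ℝ) ^ R / δ ^ 3 ≤ c := by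
  have hl : 0 ≤ logb 2 (1 / δ) := Real.logb_nonneg (by norm_num) (by
    rw [le_div_iff₀ hδ0]; linarith)
  have h0 : 0 ≤ R + 3 * logb 2 (1 / δ) := by positivity
  obtain ⟨n, hn⟩ := Int.eq_ofNat_of_zero_le (Int.ceil_nonneg h0)
  refine ⟨2 ^ n, by positivity, ?_, ?_⟩
  · rw [hn]; push_cast; simp
  · have h1 : R + 3 * logb 2 (1 / δ) ≤ (n : ℝ) := by
      have := Int.le_ceil (R + 3 * logb 2 (1 / δ))
      rw [hn] at this; exact_mod_cast this
    have h2 : (2 : ℝ) ^ (R + 3 * logb 2 (1 / δ)) = 2 ^ R / δ ^ 3 := by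
      rw [Real.rpow_add (by norm_num), mul_comm 3, Real.rpow_mul (by norm_num),
        Real.rpow_logb (by norm_num) (by norm_num) (by positivity)]
      rw [show (3 : ℝ) = ((3 : ℕ) : ℝ) by norm_num, Real.rpow_natCast]
      field_simp
    rw [← h2]
    push_cast
    rw [← Real.rpow_natCast]
    exact Real.rpow_le_rpow_of_exponent_le (by norm_num) h1

lemma ts_num (M N D : ℕ) (hM : 0 < M) (hN : 0 < N) (δ R₁ R₂ : ℝ) (hδ0 : 0 < δ) (hδ4 : δ ≤ 1 / 4)
    (hD : (D : ℝ) = 1 / δ) (hR₁ : 0 ≤ R₁) (hR₂ : 0 ≤ R₂) (c c' : ℕ)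
    (hc : (2 : ℝ) ^ R₁ / δ ^ 3 ≤ c) (hc' : (2 : ℝ) ^ R₂ / δ ^ 3 ≤ c') :
    ∃ k : ℕ, ((D * M : ℕ) : ℝ) * ((D * N : ℕ) : ℝ) *
      (((D * M : ℕ) : ℝ) * (1 / (M : ℝ) * (1 / (N : ℝ)) * (δ * (2 : ℝ) ^ R₁ / (M * c))) +
       ((D * N : ℕ) : ℝ) * (1 / (M : ℝ) * (1 / (N : ℝ)) * (δ * (2 : ℝ) ^ R₂ / (N * c'))) +
       ((D * M : ℕ) : ℝ) * ((D * N : ℕ) : ℝ) * (1 / (M : ℝ) * (1 / (N : ℝ)) *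
        (1 / (M * c) * (1 / (N * c')) * (M * N * (1 / 2) ^ k + 2 * k * (δ ^ 4 * (2 : ℝ) ^ (R₁ + R₂ -
                logb 2 (logb 2 ((max (M : ℝ) (N : ℝ)) / δ)))))))) ≤ 4 * δ := by
  set L := logb 2 ((max (M : ℝ) (N : ℝ)) / δ) with hL
  have hM1 : (1 : ℝ) ≤ M := by exact_mod_cast hM
  have hN1 : (1 : ℝ) ≤ N := by exact_mod_cast hN
  have hmax1 : (1 : ℝ) ≤ max (M : ℝ) (N : ℝ) := le_max_of_le_left hM1
  have hmaxδ : 4 ≤ max (M : ℝ) (N : ℝ) / δ := by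
    rw [le_div_iff₀ hδ0]; linarith
  have hL2 : 2 ≤ L := by
    rw [hL, Real.le_logb_iff_rpow_le (by norm_num) (by linarith)]
    norm_num; linarith
  have hLp : (2 : ℝ) ^ L = max (M : ℝ) (N : ℝ) / δ :=
    Real.rpow_logb (by norm_num) (by norm_num) (by linarith)
  have hpow : (2 : ℝ) ^ (R₁ + R₂ - logb 2 L) = 2 ^ R₁ * 2 ^ R₂ / L := by
    rw [Real.rpow_sub (by norm_num), Real.rpow_add (by norm_num),
      Real.rpow_logb (by norm_num) (by norm_num) (by linarith)]
  rw [hpow]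
  have ha1 : (1 : ℝ) ≤ 2 ^ R₁ := Real.one_le_rpow (by norm_num) hR₁
  have hb1 : (1 : ℝ) ≤ 2 ^ R₂ := Real.one_le_rpow (by norm_num) hR₂
  set a := (2 : ℝ) ^ R₁
  set b := (2 : ℝ) ^ R₂
  have hcp : (0 : ℝ) < c := lt_of_lt_of_le (by positivity) hc
  have hcp' : (0 : ℝ) < c' := lt_of_lt_of_le (by positivity) hc'
  have hac : a / c ≤ δ ^ 3 := by
    rw [div_le_iff₀ (by positivity)] at hc
    rw [div_le_iff₀ hcp]; linarith
  have hbc : b / c' ≤ δ ^ 3 := by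
    rw [div_le_iff₀ (by positivity)] at hc'
    rw [div_le_iff₀ hcp']; linarith
  have hac0 : 0 ≤ a / c := by positivity
  have hbc0 : 0 ≤ b / c' := by positivity
  have h1c : 1 / (c : ℝ) ≤ δ ^ 3 := le_trans (div_le_div_of_nonneg_right ha1 hcp.le) hac
  have h1c' : 1 / (c' : ℝ) ≤ δ ^ 3 := le_trans (div_le_div_of_nonneg_right hb1 hcp'.le) hbc
  refine ⟨⌈2 * L⌉₊, ?_⟩
  have hk1 : 2 * L ≤ (⌈2 * L⌉₊ : ℝ) := Nat.le_ceil _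
  have hk2 : (⌈2 * L⌉₊ : ℝ) < 2 * L + 1 := Nat.ceil_lt_add_one (by linarith)
  set k := ⌈2 * L⌉₊
  have hMN : (M : ℝ) * N * (1 / 2) ^ k ≤ δ ^ 2 := by
    have h1 : (max (M : ℝ) (N : ℝ) / δ) ^ 2 ≤ (2 : ℝ) ^ k := by
      rw [← hLp, ← Real.rpow_natCast, ← Real.rpow_natCast, ← Real.rpow_mul (by norm_num)]
      refine Real.rpow_le_rpow_of_exponent_le (by norm_num) ?_
      push_cast; linarith
    have h2 : (M : ℝ) * N ≤ max (M : ℝ) (N : ℝ) ^ 2 := by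
      rw [sq]; exact mul_le_mul (le_max_left _ _) (le_max_right _ _) (by positivity) (by positivity)
    rw [one_div, inv_pow, ← div_eq_mul_inv, div_le_iff₀ (by positivity)]
    rw [div_pow, div_le_iff₀ (by positivity)] at h1
    linarith
  have hD2 : (D : ℝ) * δ = 1 := by rw [hD]; field_simp
  have hM0 : (M : ℝ) ≠ 0 := by positivity
  have hN0 : (N : ℝ) ≠ 0 := by positivity
  have hexp : ((D * M : ℕ) : ℝ) * ((D * N : ℕ) : ℝ) *
      (((D * M : ℕ) : ℝ) * (1 / (M : ℝ) * (1 / (N : ℝ)) * (δ * a / (M * c))) +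
       ((D * N : ℕ) : ℝ) * (1 / (M : ℝ) * (1 / (N : ℝ)) * (δ * b / (N * c'))) +
       ((D * M : ℕ) : ℝ) * ((D * N : ℕ) : ℝ) * (1 / (M : ℝ) * (1 / (N : ℝ)) *
        (1 / (M * c) * (1 / (N * c')) * (M * N * (1 / 2) ^ k + 2 * k * (δ ^ 4 * (a * b / L))))))
      = D ^ 3 * δ * (a / c) + D ^ 3 * δ * (b / c') +
        (D ^ 4 * ((M * N * (1 / 2) ^ k) * ((1 / c) * (1 / c'))) +
          D ^ 4 * δ ^ 4 * (2 * (k / L)) * ((a / c) * (b / c'))) := by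
    push_cast
    have hL0 : L ≠ 0 := by linarith
    have hc0 : (c : ℝ) ≠ 0 := hcp.ne'
    have hc0' : (c' : ℝ) ≠ 0 := hcp'.ne'
    field_simp
  rw [hexp]
  have hD0 : (0 : ℝ) ≤ D := by positivity
  have t1 : D ^ 3 * δ * (a / c) ≤ δ := by
    calc D ^ 3 * δ * (a / c) ≤ D ^ 3 * δ * δ ^ 3 := mul_le_mul_of_nonneg_left hac (by positivity)
      _ = (D * δ) ^ 3 * δ := by ring
      _ = δ := by rw [hD2]; ring
  have t2 : D ^ 3 * δ * (b / c') ≤ δ := by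
    calc D ^ 3 * δ * (b / c') ≤ D ^ 3 * δ * δ ^ 3 := mul_le_mul_of_nonneg_left hbc (by positivity)
      _ = (D * δ) ^ 3 * δ := by ring
      _ = δ := by rw [hD2]; ring
  have t3 : D ^ 4 * ((M * N * (1 / 2) ^ k) * ((1 / c) * (1 / c'))) ≤ δ := by
    calc D ^ 4 * ((M * N * (1 / 2) ^ k) * ((1 / c) * (1 / c' : ℝ))) ≤
        D ^ 4 * (δ ^ 2 * (δ ^ 3 * δ ^ 3)) := by
          refine mul_le_mul_of_nonneg_left ?_ (by positivity)
          refine mul_le_mul hMN ?_ (by positivity) (by positivity)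
          exact mul_le_mul h1c h1c' (by positivity) (by positivity)
      _ = (D * δ) ^ 4 * δ ^ 4 := by ring
      _ = δ ^ 4 := by rw [hD2]; ring
      _ ≤ δ := by
          calc δ ^ 4 ≤ δ ^ 1 := pow_le_pow_of_le_one hδ0.le (by linarith) (by norm_num)
            _ = δ := pow_one _
  have t4 : D ^ 4 * δ ^ 4 * (2 * (k / L)) * ((a / c) * (b / c')) ≤ δ := by
    have hkL : (k : ℝ) / L ≤ 3 := by rw [div_le_iff₀ (by linarith)]; linarith
    have hkL0 : 0 ≤ (k : ℝ) / L := by positivity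
    calc D ^ 4 * δ ^ 4 * (2 * (k / L)) * ((a / c) * (b / c')) ≤
        D ^ 4 * δ ^ 4 * (2 * 3) * (δ ^ 3 * δ ^ 3) := by
          refine mul_le_mul ?_ (mul_le_mul hac hbc hbc0 (by positivity)) (by positivity) (by positivity)
          refine mul_le_mul_of_nonneg_left (by linarith) (by positivity)
      _ = (D * δ) ^ 4 * (6 * δ ^ 6) := by ring
      _ = 6 * δ ^ 6 := by rw [hD2]; ring
      _ ≤ δ := by
          have : δ ^ 6 ≤ δ ^ 3 := pow_le_pow_of_le_one hδ0.le (by linarith) (by norm_num)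
          have h2 : δ ^ 3 ≤ δ * (1 / 16) := by nlinarith
          linarith
  linarith

lemma ts_sum_XM (p : 𝒳 → 𝒴 → 𝒵 → ℳ → 𝒩 → ℝ) (x : 𝒳) : ∑ m, margXM p x m = margX p x := by
  unfold margXM margX
  rw [Finset.sum_comm]
  exact Finset.sum_congr rfl fun y _ => Finset.sum_comm

lemma ts_sum_YN (p : 𝒳 → 𝒴 → 𝒵 → ℳ → 𝒩 → ℝ) (y : 𝒴) : ∑ n, margYN p y n = margY p y := by
  unfold margYN margY
  rw [Finset.sum_comm]
  refine Finset.sum_congr rfl fun x _ => ?_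
  rw [Finset.sum_comm]
  exact Finset.sum_congr rfl fun z _ => Finset.sum_comm

lemma ts_sum_M (p : 𝒳 → 𝒴 → 𝒵 → ℳ → 𝒩 → ℝ) (n : 𝒩) (z : 𝒵) :
    ∑ m, margMNZ p m n z = margNZ p n z := by
  unfold margMNZ margNZ
  rw [Finset.sum_comm]
  exact Finset.sum_congr rfl fun x _ => Finset.sum_comm

lemma ts_sum_N (p : 𝒳 → 𝒴 → 𝒵 → ℳ → 𝒩 → ℝ) (m : ℳ) (z : 𝒵) :
    ∑ n, margMNZ p m n z = margMZ p m z := by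
  unfold margMNZ margMZ
  rw [Finset.sum_comm]
  exact Finset.sum_congr rfl fun x _ => Finset.sum_comm

lemma ts_sum_MN (p : 𝒳 → 𝒴 → 𝒵 → ℳ → 𝒩 → ℝ) (z : 𝒵) :
    ∑ m, ∑ n, margMNZ p m n z = margZ p z := by
  simp_rw [ts_sum_N]
  unfold margMZ margZ
  rw [Finset.sum_comm]
  exact Finset.sum_congr rfl fun x _ => Finset.sum_comm

lemma ts_MNZ0 (p : 𝒳 → 𝒴 → 𝒵 → ℳ → 𝒩 → ℝ) (hp : ∀ x y z m n, 0 ≤ p x y z m n)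
    (m : ℳ) (n : 𝒩) (z : 𝒵) : 0 ≤ margMNZ p m n z :=
  sum_nonneg fun _ _ => sum_nonneg fun _ _ => hp _ _ _ _ _

lemma ts_XM0 (p : 𝒳 → 𝒴 → 𝒵 → ℳ → 𝒩 → ℝ) (hp : ∀ x y z m n, 0 ≤ p x y z m n)
    (x : 𝒳) (m : ℳ) : 0 ≤ margXM p x m :=
  sum_nonneg fun _ _ => sum_nonneg fun _ _ => sum_nonneg fun _ _ => hp _ _ _ _ _

lemma ts_YN0 (p : 𝒳 → 𝒴 → 𝒵 → ℳ → 𝒩 → ℝ) (hp : ∀ x y z m n, 0 ≤ p x y z m n)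
    (y : 𝒴) (n : 𝒩) : 0 ≤ margYN p y n :=
  sum_nonneg fun _ _ => sum_nonneg fun _ _ => sum_nonneg fun _ _ => hp _ _ _ _ _

lemma ts_XYZ0 (p : 𝒳 → 𝒴 → 𝒵 → ℳ → 𝒩 → ℝ) (hp : ∀ x y z m n, 0 ≤ p x y z m n)
    (x : 𝒳) (y : 𝒴) (z : 𝒵) : 0 ≤ margXYZ p x y z :=
  sum_nonneg fun _ _ => sum_nonneg fun _ _ => hp _ _ _ _ _

lemma ts_XYZ_le_X (p : 𝒳 → 𝒴 → 𝒵 → ℳ → 𝒩 → ℝ) (hp : ∀ x y z m n, 0 ≤ p x y z m n)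
    (x : 𝒳) (y : 𝒴) (z : 𝒵) : margXYZ p x y z ≤ margX p x :=
  (single_le_sum (f := fun z => margXYZ p x y z) (fun z _ => ts_XYZ0 p hp x y z)
    (mem_univ z)).trans
  (single_le_sum (f := fun y => ∑ z, margXYZ p x y z)
    (fun y _ => sum_nonneg fun z _ => ts_XYZ0 p hp x y z) (mem_univ y))

lemma ts_XYZ_le_Y (p : 𝒳 → 𝒴 → 𝒵 → ℳ → 𝒩 → ℝ) (hp : ∀ x y z m n, 0 ≤ p x y z m n)
    (x : 𝒳) (y : 𝒴) (z : 𝒵) : margXYZ p x y z ≤ margY p y :=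
  (single_le_sum (f := fun z => margXYZ p x y z) (fun z _ => ts_XYZ0 p hp x y z)
    (mem_univ z)).trans
  (single_le_sum (f := fun x => ∑ z, margXYZ p x y z)
    (fun x _ => sum_nonneg fun z _ => ts_XYZ0 p hp x y z) (mem_univ x))

lemma ts_le_XYZ (p : 𝒳 → 𝒴 → 𝒵 → ℳ → 𝒩 → ℝ) (hp : ∀ x y z m n, 0 ≤ p x y z m n)
    (x : 𝒳) (y : 𝒴) (z : 𝒵) (m : ℳ) (n : 𝒩) : p x y z m n ≤ margXYZ p x y z :=
  (single_le_sum (f := fun n => p x y z m n) (fun n _ => hp x y z m n)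
    (mem_univ n)).trans
  (single_le_sum (f := fun m => ∑ n, p x y z m n)
    (fun m _ => sum_nonneg fun n _ => hp x y z m n) (mem_univ m))

lemma ts_le_MNZ (p : 𝒳 → 𝒴 → 𝒵 → ℳ → 𝒩 → ℝ) (hp : ∀ x y z m n, 0 ≤ p x y z m n)
    (x : 𝒳) (y : 𝒴) (z : 𝒵) (m : ℳ) (n : 𝒩) : p x y z m n ≤ margMNZ p m n z :=
  (single_le_sum (f := fun y => p x y z m n) (fun y _ => hp x y z m n)
    (mem_univ y)).trans
  (single_le_sum (f := fun x => ∑ y, p x y z m n)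
    (fun x _ => sum_nonneg fun y _ => hp x y z m n) (mem_univ x))

lemma ts_MNZ_le_NZ (p : 𝒳 → 𝒴 → 𝒵 → ℳ → 𝒩 → ℝ) (hp : ∀ x y z m n, 0 ≤ p x y z m n)
    (z : 𝒵) (m : ℳ) (n : 𝒩) : margMNZ p m n z ≤ margNZ p n z := by
  rw [← ts_sum_M]
  exact single_le_sum (f := fun m => margMNZ p m n z) (fun m _ => ts_MNZ0 p hp m n z) (mem_univ m)

lemma ts_MNZ_le_MZ (p : 𝒳 → 𝒴 → 𝒵 → ℳ → 𝒩 → ℝ) (hp : ∀ x y z m n, 0 ≤ p x y z m n)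
    (z : 𝒵) (m : ℳ) (n : 𝒩) : margMNZ p m n z ≤ margMZ p m z := by
  rw [← ts_sum_N]
  exact single_le_sum (f := fun n => margMNZ p m n z) (fun n _ => ts_MNZ0 p hp m n z) (mem_univ n)

lemma ts_MNZ_le_Z (p : 𝒳 → 𝒴 → 𝒵 → ℳ → 𝒩 → ℝ) (hp : ∀ x y z m n, 0 ≤ p x y z m n)
    (z : 𝒵) (m : ℳ) (n : 𝒩) : margMNZ p m n z ≤ margZ p z := by
  rw [← ts_sum_MN]
  simp_rw [ts_sum_N]
  refine (ts_MNZ_le_MZ p hp z m n).trans ?_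
  refine single_le_sum (f := fun m => margMZ p m z) (fun m _ => ?_) (mem_univ m)
  exact (ts_MNZ0 p hp m n z).trans (ts_MNZ_le_MZ p hp z m n)

lemma ts_div_le {a b q : ℝ} (hb : 0 < b) (h : a / b ≤ q) : a ≤ q * b := by
  rwa [div_le_iff₀ hb] at h

/-- Theorem 3.2 / main achievability result: if
`Pr[ p_{M|X}/p_{M|NZ} ≤ δ·2^{R₁} and p_{N|Y}/p_{N|MZ} ≤ δ·2^{R₂} and
p_{M|X}·p_{N|Y}/p_{MN|Z} ≤ δ⁴·2^{R₁+R₂−log log(max(|ℳ|,|𝒩|)/δ)} ] ≥ 1−ε`,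
then there is an `(R₁+3 log(1/δ), R₂+3 log(1/δ), ε+8δ)` two-senders–one-receiver
message compression scheme with side information at the receiver. -/
theorem two_sender_compression_achievability
    (p : 𝒳 → 𝒴 → 𝒵 → ℳ → 𝒩 → ℝ) (hdist : IsDist p) (hMarkov : MarkovCond p)
    (ε δ : ℝ) (hε0 : 0 < ε) (hε1 : ε < 1) (hδ0 : 0 < δ) (hδ1 : δ < 1)
    (hδint : ∃ k : ℕ, (k : ℝ) = 1 / Real.sqrt δ)
    (R₁ R₂ : ℝ) (hR₁ : 0 ≤ R₁) (hR₂ : 0 ≤ R₂)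
    (hPr : 1 - ε ≤ ∑ x, ∑ y, ∑ z, ∑ m, ∑ n,
        (if condMX p x m / condM_NZ p m n z ≤ δ * (2 : ℝ) ^ R₁ ∧
            condNY p y n / condN_MZ p n m z ≤ δ * (2 : ℝ) ^ R₂ ∧
            condMX p x m * condNY p y n / condMN_Z p m n z ≤
              δ ^ 4 * (2 : ℝ) ^ (R₁ + R₂ -
                logb 2 (logb 2 ((max (Fintype.card ℳ) (Fintype.card 𝒩) : ℝ) / δ)))
          then p x y z m n else 0)) :
    IsTwoSenderScheme p (R₁ + 3 * logb 2 (1 / δ)) (R₂ + 3 * logb 2 (1 / δ)) (ε + 8 * δ) := by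
  obtain ⟨hp, hsum⟩ := hdist
  -- nonemptiness
  have hne : ∃ x y z m n, p x y z m n ≠ 0 := by
    by_contra hcon
    push Not at hcon
    simp [hcon] at hsum
  obtain ⟨x0, y0, z0, m0, n0, -⟩ := hne
  haveI : Nonempty ℳ := ⟨m0⟩
  haveI : Nonempty 𝒩 := ⟨n0⟩
  -- δ = 1 / D
  obtain ⟨k0, hk0⟩ := hδint
  have hsq : 0 < Real.sqrt δ := Real.sqrt_pos.2 hδ0
  have hsq1 : Real.sqrt δ < 1 := by
    rw [Real.sqrt_lt' (by norm_num)]; linarith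
  have hk1 : (1 : ℝ) < k0 := by
    rw [hk0, lt_div_iff₀ hsq]; linarith
  have hk2 : (2 : ℝ) ≤ k0 := by
    have : 1 < k0 := by exact_mod_cast hk1
    exact_mod_cast this
  obtain ⟨D, hDdef⟩ : ∃ D : ℕ, D = k0 ^ 2 := ⟨_, rfl⟩
  have hD : (D : ℝ) = 1 / δ := by
    rw [hDdef]; push_cast; rw [hk0, div_pow, Real.sq_sqrt hδ0.le, one_pow]
  have hδ4 : δ ≤ 1 / 4 := by
    have h4 : (4 : ℝ) ≤ D := by rw [hDdef]; push_cast; nlinarith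
    rw [hD, le_div_iff₀ hδ0] at h4
    linarith
  obtain ⟨cA, hcA0, hcA1, hcA2⟩ := ts_rate δ R₁ hδ0 hδ1 hR₁
  obtain ⟨cB, hcB0, hcB1, hcB2⟩ := ts_rate δ R₂ hδ0 hδ1 hR₂
  obtain ⟨k, hk⟩ := ts_num (Fintype.card ℳ) (Fintype.card 𝒩) D Fintype.card_pos Fintype.card_pos
    δ R₁ R₂ hδ0 hδ4 hD hR₁ hR₂ cA cB hcA2 hcB2
  have hX0 : ∀ x, 0 ≤ margX p x := fun x => by
    rw [← ts_sum_XM]; exact sum_nonneg fun m _ => ts_XM0 p hp x m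
  have hY0 : ∀ y, 0 ≤ margY p y := fun y => by
    rw [← ts_sum_YN]; exact sum_nonneg fun m _ => ts_YN0 p hp y m
  have hP0 : ∀ x m, 0 ≤ condMX p x m := fun x m => div_nonneg (ts_XM0 p hp x m) (hX0 x)
  have hQ0 : ∀ y n, 0 ≤ condNY p y n := fun y n => div_nonneg (ts_YN0 p hp y n) (hY0 y)
  have hP1 : ∀ x m, condMX p x m ≤ 1 := fun x m => div_le_one_of_le₀ (by
    rw [← ts_sum_XM]
    exact single_le_sum (f := fun m => margXM p x m) (fun m _ => ts_XM0 p hp x m) (mem_univ m))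
    (hX0 x)
  have hQ1 : ∀ x m, condNY p x m ≤ 1 := fun x m => div_le_one_of_le₀ (by
    rw [← ts_sum_YN]
    exact single_le_sum (f := fun m => margYN p x m) (fun m _ => ts_YN0 p hp x m) (mem_univ m))
    (hY0 x)
  obtain ⟨NA, wA, mA, uA, hA, a1, a2, a3, a4, haccA, a6⟩ := ts_sampler (condMX p) hP0 hP1 cA hcA0
  obtain ⟨NB, wB, mB, uB, hB, b1, b2, b3, b4, haccB, b6⟩ := ts_sampler (condNY p) hQ0 hQ1 cB hcB0
  let S : TsSampler ℳ cA := ⟨NA, wA, mA, uA, hA, a1, a2, a3, a4, a6⟩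
  let S' : TsSampler 𝒩 cB := ⟨NB, wB, mB, uB, hB, b1, b2, b3, b4, b6⟩
  let K := D * Fintype.card ℳ
  let K' := D * Fintype.card 𝒩
  let c3 : ℝ := δ ^ 4 * (2 : ℝ) ^ (R₁ + R₂ -
                logb 2 (logb 2 ((max (Fintype.card ℳ) (Fintype.card 𝒩) : ℝ) / δ)))
  have hc3 : 0 ≤ c3 := by positivity
  let t1 : 𝒵 → ℳ → 𝒩 → ℝ := fun z m n => δ * (2 : ℝ) ^ R₁ * condM_NZ p m n z
  let t2 : 𝒵 → ℳ → 𝒩 → ℝ := fun z m n => δ * (2 : ℝ) ^ R₂ * condN_MZ p n m z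
  let t3 : 𝒵 → ℳ → 𝒩 → ℝ := fun z m n => c3 * condMN_Z p m n z
  have hNZ0 : ∀ n z, 0 ≤ margNZ p n z := fun n z =>
    (ts_MNZ0 p hp m0 n z).trans (ts_MNZ_le_NZ p hp z m0 n)
  have hMZ0 : ∀ m z, 0 ≤ margMZ p m z := fun m z =>
    (ts_MNZ0 p hp m n0 z).trans (ts_MNZ_le_MZ p hp z m n0)
  have hZ0 : ∀ z, 0 ≤ margZ p z := fun z =>
    (ts_MNZ0 p hp m0 n0 z).trans (ts_MNZ_le_Z p hp z m0 n0)
  have ht1 : ∀ z m n, 0 ≤ t1 z m n := fun z m n =>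
    mul_nonneg (by positivity) (div_nonneg (ts_MNZ0 p hp m n z) (hNZ0 n z))
  have ht2 : ∀ z m n, 0 ≤ t2 z m n := fun z m n =>
    mul_nonneg (by positivity) (div_nonneg (ts_MNZ0 p hp m n z) (hMZ0 m z))
  have ht3 : ∀ z m n, 0 ≤ t3 z m n := fun z m n =>
    mul_nonneg hc3 (div_nonneg (ts_MNZ0 p hp m n z) (hZ0 z))
  have hT1 : ∀ z n, ∑ m, t1 z m n ≤ δ * (2 : ℝ) ^ R₁ := by
    intro z n
    simp only [t1, condM_NZ]
    rw [← Finset.mul_sum, ← Finset.sum_div, ts_sum_M]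
    exact mul_le_of_le_one_right (by positivity) (div_self_le_one _)
  have hT2 : ∀ z m, ∑ n, t2 z m n ≤ δ * (2 : ℝ) ^ R₂ := by
    intro z m
    simp only [t2, condN_MZ]
    rw [← Finset.mul_sum, ← Finset.sum_div, ts_sum_N]
    exact mul_le_of_le_one_right (by positivity) (div_self_le_one _)
  have hT3 : ∀ z, ∑ m, ∑ n, t3 z m n ≤ c3 := by
    intro z
    simp only [t3, condMN_Z, ← Finset.mul_sum, ← Finset.sum_div]
    rw [ts_sum_MN]
    exact mul_le_of_le_one_right hc3 (div_self_le_one _)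
  obtain ⟨T, hTdef⟩ : ∃ T : 𝒳 → 𝒴 → 𝒵 → ℳ → 𝒩 → Prop, ∀ x y z m n, T x y z m n ↔
    ((condMX p x m / condM_NZ p m n z ≤ δ * (2 : ℝ) ^ R₁ ∧
            condNY p y n / condN_MZ p n m z ≤ δ * (2 : ℝ) ^ R₂ ∧
            condMX p x m * condNY p y n / condMN_Z p m n z ≤ c3) ∧ 0 < p x y z m n) := ⟨_, fun _ _ _ _ _ => Iff.rfl⟩
  have hTt : ∀ x y z m n, T x y z m n → condMX p x m ≤ t1 z m n ∧ condNY p y n ≤ t2 z m n ∧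
      condMX p x m * condNY p y n ≤ t3 z m n := by
    intro x y z m n hT
    obtain ⟨⟨h1, h2, h3⟩, hpos⟩ := (hTdef x y z m n).1 hT
    have hMNZ := hpos.trans_le (ts_le_MNZ p hp x y z m n)
    exact ⟨ts_div_le (div_pos hMNZ (hMNZ.trans_le (ts_MNZ_le_NZ p hp z m n))) h1,
      ts_div_le (div_pos hMNZ (hMNZ.trans_le (ts_MNZ_le_MZ p hp z m n))) h2,
      ts_div_le (div_pos hMNZ (hMNZ.trans_le (ts_MNZ_le_Z p hp z m n))) h3⟩
  have hfA := ts_fail (Fintype.card ℳ) D K Fintype.card_pos rfl δ hδ0 hD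
  have hfB := ts_fail (Fintype.card 𝒩) D K' Fintype.card_pos rfl δ hδ0 hD
  let d0 : ℳ × 𝒩 := (m0, n0)
  let V : 𝒳 → 𝒴 → 𝒵 → ℳ → 𝒩 → ℝ := fun x y z m n =>
    tsE S S' (fun (s : Fin K → Fin S.N) (r : Fin K' → Fin S'.N) =>
      tsV S S' (S.acc (condMX p x)) (S'.acc (condNY p y)) (t1 z) (t2 z) (t3 z) (T x y z) m n s r)
  let G : 𝒳 → 𝒴 → 𝒵 → ℳ → 𝒩 → ℝ := fun x y z m n =>
    tsE S S' (fun (s : Fin K → Fin S.N) (r : Fin K' → Fin S'.N) =>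
      (if tsDec S S' (t1 z) (t2 z) (t3 z) d0 (tsEnc S (S.acc (condMX p x)) ⟨0, hcA0⟩ s)
        (tsEnc S' (S'.acc (condNY p y)) ⟨0, hcB0⟩ r) s r = (m, n) then 1 else 0))
  have hVG : ∀ x y z m n, V x y z m n ≤ G x y z m n := by
    intro x y z m n
    exact tsE_mono S S' _ _ fun s r => tsV_le_dec S S' (condMX p x) (condNY p y) (hP0 x)
      (t1 z) (t2 z) (t3 z) (T x y z) (hTt x y z) d0 _ _ m n s r
  have hG1 : ∀ x y z, ∑ m, ∑ n, G x y z m n = 1 := by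
    intro x y z
    have h1 := tsE_one S S' (K := K) (K' := K')
    simp only [G]
    simp_rw [← tsE_sum]
    refine Eq.trans ?_ h1
    congr 1
    funext s r
    rw [← Fintype.sum_prod_type']
    simp
  have hsX : ∀ x y z, 0 < margXYZ p x y z → ∑ m, condMX p x m = 1 := by
    intro x y z h
    simp only [condMX]
    rw [← Finset.sum_div, ts_sum_XM, div_self (h.trans_le (ts_XYZ_le_X p hp x y z)).ne']
  have hsY : ∀ x y z, 0 < margXYZ p x y z → ∑ m, condNY p y m = 1 := by
    intro x y z h
    simp only [condNY]
    rw [← Finset.sum_div, ts_sum_YN, div_self (h.trans_le (ts_XYZ_le_Y p hp x y z)).ne']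
  have hWp : ∀ x y z m n, margXYZ p x y z * V x y z m n ≤ p x y z m n := by
    intro x y z m n
    rcases (ts_XYZ0 p hp x y z).eq_or_lt with h | h
    · rw [← h, zero_mul]; exact hp _ _ _ _ _
    · rw [hMarkov x y z m n h, mul_assoc]
      exact mul_le_mul_of_nonneg_left (ts_core_upper S S' (condMX p x) (condNY p y) (hP0 x) (hQ0 y)
        (hsX x y z h) (hsY x y z h) (haccA x) (haccB y) hfA.1 hfB.1 _ _ _ _ m n) h.le
  have hWlow : ∀ x y z, (∑ m, ∑ n, (if T x y z m n then p x y z m n else 0))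
      - margXYZ p x y z * (8 * δ) ≤ ∑ m, ∑ n, margXYZ p x y z * V x y z m n := by
    intro x y z
    rcases (ts_XYZ0 p hp x y z).eq_or_lt with h | h
    · have hz : ∀ m n, p x y z m n = 0 := fun m n =>
        le_antisymm ((ts_le_XYZ p hp x y z m n).trans h.ge) (hp _ _ _ _ _)
      rw [← h]; simp [hz]
    · have hX : ∀ h h', ∑ a, ∑ b, S.w a * S'.w b * (if S.hh a = h ∧ S'.hh b = h' ∧
          S.uu a * S'.uu b ≤ t3 z (S.mm a) (S'.mm b) then 1 else 0) ≤
          1 / (Fintype.card ℳ * cA : ℝ) * (1 / (Fintype.card 𝒩 * cB)) *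
          (Fintype.card ℳ * Fintype.card 𝒩 * (1 / 2) ^ k + 2 * k * c3) := by
        intro h h'
        refine (ts_hit2 S S' (t3 z) (ht3 z) h h' k).trans ?_
        refine mul_le_mul_of_nonneg_left ?_ (by positivity)
        have := mul_le_mul_of_nonneg_left (hT3 z) (show (0 : ℝ) ≤ 2 * k by positivity)
        linarith
      have hcoll := (ts_coll S S' (K := K) (K' := K') (S.acc (condMX p x)) (S'.acc (condNY p y))
        (1 / Fintype.card ℳ) (1 / Fintype.card 𝒩) (by positivity) (by positivity)
        (ts_acc_tot S _ (hsX x y z h) (haccA x)) (ts_acc_tot S' _ (hsY x y z h) (haccB y))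
        (t1 z) (t2 z) (t3 z) (ht1 z) (ht2 z) _ _ _ (hT1 z) (hT2 z) (by positivity) (by positivity)
        (by positivity) hX).trans hk
      have hlow := ts_core_lower S S' (condMX p x) (condNY p y) (hP0 x) (hQ0 y)
        (hsX x y z h) (hsY x y z h) (haccA x) (haccB y) δ _ hfA hfB (t1 z) (t2 z) (t3 z)
        (T x y z) hcoll
      have e1 : ∑ m, ∑ n, (if T x y z m n then p x y z m n else 0) = margXYZ p x y z *
          ∑ m, ∑ n, (if T x y z m n then condMX p x m * condNY p y n else 0) := by
        simp only [Finset.mul_sum]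
        refine Finset.sum_congr rfl fun m _ => Finset.sum_congr rfl fun n _ => ?_
        rw [hMarkov x y z m n h]
        split_ifs <;> ring
      simp only [← Finset.mul_sum]
      rw [e1, ← mul_sub]
      refine mul_le_mul_of_nonneg_left ?_ h.le
      refine le_trans ?_ hlow
      linarith
  have hXYZ1 : ∑ x, ∑ y, ∑ z, margXYZ p x y z = 1 := hsum
  have hWtot : 1 - ε - 8 * δ ≤ ∑ x, ∑ y, ∑ z, ∑ m, ∑ n, margXYZ p x y z * V x y z m n := by
    have h1 : ∑ x, ∑ y, ∑ z, ((∑ m, ∑ n, (if T x y z m n then p x y z m n else 0))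
      - margXYZ p x y z * (8 * δ)) ≤ ∑ x, ∑ y, ∑ z, ∑ m, ∑ n, margXYZ p x y z * V x y z m n :=
      sum_le_sum fun x _ => sum_le_sum fun y _ => sum_le_sum fun z _ => hWlow x y z
    simp only [Finset.sum_sub_distrib, ← Finset.sum_mul] at h1
    rw [hXYZ1, one_mul] at h1
    refine le_trans ?_ h1
    refine sub_le_sub_right (hPr.trans (le_of_eq ?_)) _
    refine Finset.sum_congr rfl fun x _ => Finset.sum_congr rfl fun y _ =>
      Finset.sum_congr rfl fun z _ => Finset.sum_congr rfl fun m _ =>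
      Finset.sum_congr rfl fun n _ => ?_
    rcases (hp x y z m n).eq_or_lt with h | h
    · simp only [← h, ite_self]
    · refine if_congr ?_ rfl rfl
      simp only [hTdef, h, and_true, c3]
  refine ts_scheme_of_fintype p _ _ _ (Fin K → Fin S.N) (Fin K' → Fin S'.N) cA cB S.pr S'.pr
    (fun x s => tsEnc S (S.acc (condMX p x)) ⟨0, hcA0⟩ s)
    (fun y r => tsEnc S' (S'.acc (condNY p y)) ⟨0, hcB0⟩ r)
    (fun a b z s r => tsDec S S' (t1 z) (t2 z) (t3 z) d0 a b s r)
    S.pr0 (ts_E0 K S.w S.w1) S'.pr0 (ts_E0 K' S'.w S'.w1) hcA1 hcB1 ?_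
  change (1 / 2) * (∑ x, ∑ y, ∑ z, ∑ m, ∑ n,
      |margXYZ p x y z * G x y z m n - p x y z m n|) ≤ ε + 8 * δ
  have hfin : ∑ x, ∑ y, ∑ z, ∑ m, ∑ n, |margXYZ p x y z * G x y z m n - p x y z m n| ≤
      ∑ x, ∑ y, ∑ z, ∑ m, ∑ n, (margXYZ p x y z * G x y z m n + p x y z m n
        - 2 * (margXYZ p x y z * V x y z m n)) := by
    refine sum_le_sum fun x _ => sum_le_sum fun y _ => sum_le_sum fun z _ =>
      sum_le_sum fun m _ => sum_le_sum fun n _ => ?_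
    have h1 := hWp x y z m n
    have h2 := mul_le_mul_of_nonneg_left (hVG x y z m n) (ts_XYZ0 p hp x y z)
    rw [abs_le]
    constructor <;> linarith
  have hGtot : ∑ x, ∑ y, ∑ z, ∑ m, ∑ n, margXYZ p x y z * G x y z m n = 1 := by
    simp only [← Finset.mul_sum, hG1, mul_one]
    exact hXYZ1
  simp only [Finset.sum_sub_distrib, Finset.sum_add_distrib] at hfin
  rw [hGtot, hsum] at hfin
  have e2 : ∑ x, ∑ y, ∑ z, ∑ m, ∑ n, 2 * (margXYZ p x y z * V x y z m n) =
      2 * ∑ x, ∑ y, ∑ z, ∑ m, ∑ n, margXYZ p x y z * V x y z m n := by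
    simp only [Finset.mul_sum]
  rw [e2] at hfin
  linarith

end
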